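/- arXiv:1311.2272 — 9 statements merged into one kernel-verified Lean document; each statement's English description precedes it below -/
import Mathlib

section
/- Let D be a probability distribution on a set X and let m be an even positive integer. Draw X_1, ..., X_m independently according to D, and form the labeled sample S = {(X_1,1),(X_2,0),(X_3,1),(X_4,0),...,(X_{m-1},1),(X_m,0)}. Then for every function h : X → {0,1}, the probability (over the draw of X_1,...,X_m) that Err_S(h) ≤ 1/5 is at most 2^{-(9/100)m}. -/
open MeasureTheory

lemma alt_prod (A B : ℝ) (k : ℕ) :
    ∏ i ∈ Finset.range (k + k), (if i % 2 = 0 then A else B) = (A * B) ^ k := by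
  induction k with
  | zero => simp
  | succ n ih =>
    rw [show n + 1 + (n + 1) = n + n + 1 + 1 by omega, Finset.prod_range_succ,
      Finset.prod_range_succ, ih, if_pos (by omega), if_neg (by omega), pow_succ]
    ring

lemma num_bound (k : ℕ) (hk : 0 < k) :
    ((9 : ℝ) / 16) ^ k ≤ (2 : ℝ) ^ (-(9 / 100 : ℝ) * ((k + k : ℕ) : ℝ))
      * (2 : ℝ) ^ (-(1 / 5 : ℝ) * ((k + k : ℕ) : ℝ)) := by
  rw [← Real.rpow_add (by norm_num)]
  have h1 : -(9 / 100 : ℝ) * ((k + k : ℕ) : ℝ) + -(1 / 5 : ℝ) * ((k + k : ℕ) : ℝ)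
      = (-(58 / 100) : ℝ) * k := by push_cast; ring
  rw [h1, Real.rpow_mul (by norm_num), Real.rpow_natCast]
  refine pow_le_pow_left₀ (by norm_num) ?_ k
  have h2 : (2 : ℝ) ^ (-(3 / 5) : ℝ) ≤ 2 ^ (-(58 / 100) : ℝ) :=
    Real.rpow_le_rpow_of_exponent_le (by norm_num) (by norm_num)
  refine le_trans ?_ h2
  refine le_of_pow_le_pow_left₀ (n := 5) (by norm_num) (by positivity) ?_
  rw [← Real.rpow_natCast ((2 : ℝ) ^ (-(3 / 5) : ℝ)), ← Real.rpow_mul (by norm_num)]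
  have : (-(3 / 5) : ℝ) * ((5 : ℕ) : ℝ) = ((-3 : ℤ) : ℝ) := by norm_num
  rw [this, Real.rpow_intCast]
  norm_num

/-- Let `μ` be a probability distribution on `X` and `m` an even
positive integer.  Draw `m` independent samples `x 0, …, x (m-1)` from `μ` and label
them alternately `1, 0, 1, 0, …` (so `x i` gets label `1` iff `i` is even, matching the
1-based convention where odd-indexed samples get label `1`).  Then for every
(measurable) hypothesis `h : X → Bool`, the probability that the empirical error of `h`
on this sample is at most `1/5` is at most `2 ^ (-(9/100)·m)`. -/
theorem stmt0 {X : Type*} [MeasurableSpace X] (μ : Measure X) [IsProbabilityMeasure μ]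
    (m : ℕ) (hm : 0 < m) (hme : Even m) (h : X → Bool) (hmeas : Measurable h) :
    (Measure.pi (fun _ : Fin m => μ))
      {x : Fin m → X |
        (((Finset.univ.filter
            (fun i : Fin m => h (x i) ≠ decide (i.val % 2 = 0))).card : ℝ) / m ≤ 1 / 5)}
      ≤ ENNReal.ofReal ((2 : ℝ) ^ (-(9 / 100 : ℝ) * m)) := by
  obtain ⟨k, rfl⟩ := hme
  have hk : 0 < k := by omega
  have hmR : (0 : ℝ) < ((k + k : ℕ) : ℝ) := by exact_mod_cast hm
  let b : X → ℝ := fun y => if h y = true then 1 else 0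
  have hbm : Measurable b :=
    Measurable.ite (hmeas (measurableSet_singleton true)) measurable_const measurable_const
  have hb0 : ∀ y, 0 ≤ b y := fun y => by simp only [b]; split_ifs <;> norm_num
  have hb1 : ∀ y, b y ≤ 1 := fun y => by simp only [b]; split_ifs <;> norm_num
  have hbi : Integrable b μ := by
    refine Integrable.of_bound hbm.aestronglyMeasurable 1 (Filter.Eventually.of_forall fun y => ?_)
    rw [Real.norm_eq_abs, abs_of_nonneg (hb0 y)]
    exact hb1 y
  let q : ℝ := ∫ y, b y ∂μ
  have hq0 : 0 ≤ q := integral_nonneg hb0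
  have hq1 : q ≤ 1 := by
    have := integral_mono hbi (integrable_const (1 : ℝ)) hb1
    simpa using this
  let g : Fin (k + k) → X → ℝ := fun i y => if i.val % 2 = 0 then (1 + b y) / 2 else 1 - b y / 2
  have hgi : ∀ i, Integrable (g i) μ := by
    intro i
    by_cases hi : i.val % 2 = 0
    · simp only [g, hi, if_true]
      exact ((integrable_const (1 : ℝ)).add hbi).div_const 2
    · simp only [g, hi, if_false]
      exact (integrable_const (1 : ℝ)).sub (hbi.div_const 2)
  have hgint : ∀ i, ∫ y, g i y ∂μ = if i.val % 2 = 0 then (1 + q) / 2 else 1 - q / 2 := by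
    intro i
    by_cases hi : i.val % 2 = 0
    · simp only [g, hi, if_true]
      rw [integral_div, integral_add (integrable_const (1 : ℝ)) hbi]
      simp [q]
    · simp only [g, hi, if_false]
      rw [integral_sub (integrable_const (1 : ℝ)) (hbi.div_const 2), integral_div]
      simp [q]
  have hg : ∀ i y, g i y = if h y ≠ decide (i.val % 2 = 0) then (1 / 2 : ℝ) else 1 := by
    intro i y
    by_cases hi : i.val % 2 = 0 <;> cases hy : h y <;> simp [g, b, hi, hy] <;> norm_num
  let f : (Fin (k + k) → X) → ℝ := fun x => ∏ i, g i (x i)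
  have hf : ∀ x, f x = (1 / 2 : ℝ) ^ (Finset.univ.filter
            (fun i : Fin (k + k) => h (x i) ≠ decide (i.val % 2 = 0))).card := by
    intro x
    simp only [f, hg]
    rw [Finset.prod_ite]
    simp
  have hfi : Integrable f (Measure.pi (fun _ : Fin (k + k) => μ)) :=
    Integrable.fintype_prod hgi
  have hfint : ∫ x, f x ∂(Measure.pi (fun _ : Fin (k + k) => μ)) ≤ (9 / 16 : ℝ) ^ k := by
    have e : ∫ x, f x ∂(Measure.pi (fun _ : Fin (k + k) => μ)) = ∏ i, ∫ y, g i y ∂μ :=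
      integral_fintype_prod_eq_prod g
    rw [e]
    simp only [hgint]
    rw [Fin.prod_univ_eq_prod_range (fun i => if i % 2 = 0 then (1 + q) / 2 else 1 - q / 2) (k + k),
      alt_prod]
    refine pow_le_pow_left₀ (by apply mul_nonneg <;> linarith) ?_ k
    nlinarith [sq_nonneg (q - 1 / 2)]
  set ε : ℝ := (2 : ℝ) ^ (-(1 / 5 : ℝ) * ((k + k : ℕ) : ℝ)) with hε
  have hεpos : 0 < ε := by positivity
  have hmk := mul_meas_ge_le_integral_of_nonneg
    (Filter.Eventually.of_forall fun x => by rw [hf x]; simp only [Pi.zero_apply]; positivity)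
    hfi ε
  have hsub : {x : Fin (k + k) → X |
        (((Finset.univ.filter
            (fun i : Fin (k + k) => h (x i) ≠ decide (i.val % 2 = 0))).card : ℝ)
              / ((k + k : ℕ) : ℝ) ≤ 1 / 5)} ⊆ {x | ε ≤ f x} := by
    intro x hx
    simp only [Set.mem_setOf_eq] at hx ⊢
    rw [div_le_iff₀ hmR] at hx
    rw [hf x, one_div, inv_pow, ← Real.rpow_natCast, ← Real.rpow_neg (by norm_num)]
    exact Real.rpow_le_rpow_of_exponent_le (by norm_num) (by linarith)
  refine (measure_mono hsub).trans ?_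
  rw [← ofReal_measureReal]
  refine ENNReal.ofReal_le_ofReal ?_
  have h3 := (hmk.trans hfint).trans (num_bound k hk)
  rw [mul_comm] at h3
  exact le_of_mul_le_mul_right h3 hεpos
end

section
/- There exists k_0 such that for every integer k ≥ k_0 there exists a vector y ∈ {0,1}^K (with K = k + C(k,3)) such that for every x ∈ {0,1}^K, H_k(x) = 1 implies H_k(x ⊕ y) = 0, where ⊕ denotes coordinatewise XOR. -/
/-- The index set of the coordinates of Huang's predicate: the elements of `[k]`
together with the 3-element subsets of `[k]`, so that `|Coord k| = k + C(k,3)`. -/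
def Coord (k : ℕ) : Type := Fin k ⊕ {A : Finset (Fin k) // A.card = 3}

instance (k : ℕ) : Fintype (Coord k) := by unfold Coord; infer_instance
instance (k : ℕ) : DecidableEq (Coord k) := by unfold Coord; infer_instance

/-- `y ∈ {0,1}^K` is a codeword if for every 3-element subset `A` of `[k]`, the
coordinate `y_A` equals the XOR of the coordinates `y_a`, `a ∈ A`. -/
def IsCodeword (k : ℕ) (y : Coord k → ZMod 2) : Prop :=
  ∀ A : {A : Finset (Fin k) // A.card = 3}, y (Sum.inr A) = ∑ a ∈ A.1, y (Sum.inl a)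

/-- Huang's predicate `H_k`: `H_k x = 1` iff some codeword `y` is within Hamming
distance `k` of `x`. -/
def Huang (k : ℕ) (x : Coord k → ZMod 2) : Prop :=
  ∃ y : Coord k → ZMod 2, IsCodeword k y ∧ hammingDist x y ≤ k


/-- The far-away vector: it is one exactly on the triples containing `4p, 4p+1` for some `p < 3`. -/
noncomputable def farY (k : ℕ) : Coord k → ZMod 2 := by
  classical
  exact fun c => match c with
  | Sum.inl _ => 0
  | Sum.inr A => if ∃ a ∈ A.1, ∃ b ∈ A.1, a.val + 1 = b.val ∧ a.val % 4 = 0 ∧ b.val < 12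
      then 1 else 0

/-- The coordinate of a triple with `i < j < l` or `j < i < l`. -/
def trip (k : ℕ) (i j l : Fin k) (hij : i ≠ j) (hil : i ≠ l) (hjl : j ≠ l) :
    {A : Finset (Fin k) // A.card = 3} :=
  ⟨{i, j, l}, Finset.card_eq_three.2 ⟨i, j, l, hij, hil, hjl, rfl⟩⟩

lemma farY_trip (k : ℕ) (p : ℕ) (i j l : Fin k) (hij : i ≠ j) (hil : i ≠ l) (hjl : j ≠ l)
    (hp : p < 3) (hl : 12 ≤ l.val) (hi : i.val = 4 * p ∨ i.val = 4 * p + 2)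
    (hj : j.val = 4 * p + 1 ∨ j.val = 4 * p + 3) :
    farY k (Sum.inr (trip k i j l hij hil hjl)) =
      if i.val = 4 * p ∧ j.val = 4 * p + 1 then 1 else 0 := by
  unfold farY trip
  simp only
  congr 1
  apply propext
  constructor
  · rintro ⟨a, ha, b, hb, h1, h2, h3⟩
    simp only [Finset.mem_insert, Finset.mem_singleton] at ha hb
    rcases ha with rfl | rfl | rfl <;> rcases hb with rfl | rfl | rfl <;> omega
  · rintro ⟨h1, h2⟩
    exact ⟨i, by simp, j, by simp, by omega, by omega, by omega⟩

lemma code_trip (k : ℕ) (z : Coord k → ZMod 2) (hz : IsCodeword k z) (i j l : Fin k)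
    (hij : i ≠ j) (hil : i ≠ l) (hjl : j ≠ l) :
    z (Sum.inr (trip k i j l hij hil hjl)) =
      z (Sum.inl i) + z (Sum.inl j) + z (Sum.inl l) := by
  rw [hz]
  unfold trip
  simp only
  rw [Finset.sum_insert (by simp [hij, hil]), Finset.sum_pair hjl, add_assoc]

lemma exists_bad (k : ℕ) (z : Coord k → ZMod 2) (hz : IsCodeword k z) (p : ℕ) (hp : p < 3)
    (l : Fin k) (hl : 12 ≤ l.val) :
    ∃ A : {A : Finset (Fin k) // A.card = 3},
      (farY k (Sum.inr A) ≠ z (Sum.inr A)) ∧ l ∈ A.1 ∧ (∀ a ∈ A.1, a ≠ l → a.val / 4 = p) ∧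
      (∃ a ∈ A.1, a ≠ l) := by
  have hlk := l.isLt
  by_contra hcon
  have key : ∀ i j : Fin k, (hi : i.val = 4 * p ∨ i.val = 4 * p + 2) →
      (hj : j.val = 4 * p + 1 ∨ j.val = 4 * p + 3) →
      z (Sum.inl i) + z (Sum.inl j) + z (Sum.inl l) =
        if i.val = 4 * p ∧ j.val = 4 * p + 1 then 1 else 0 := by
    intro i j hi hj
    have hij : i ≠ j := by intro h; subst h; omega
    have hil : i ≠ l := by intro h; subst h; omega
    have hjl : j ≠ l := by intro h; subst h; omega
    rw [← code_trip k z hz i j l hij hil hjl, ← farY_trip k p i j l hij hil hjl hp hl hi hj]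
    by_contra hne
    apply hcon
    refine ⟨trip k i j l hij hil hjl, fun h => hne h.symm, by simp [trip], ?_, i, by simp [trip],
      hil⟩
    intro a ha hal
    simp only [trip, Finset.mem_insert, Finset.mem_singleton] at ha
    rcases ha with rfl | rfl | rfl
    · omega
    · omega
    · exact absurd rfl hal
  have h1 := key ⟨4 * p, by omega⟩ ⟨4 * p + 1, by omega⟩ (by simp) (by simp)
  have h2 := key ⟨4 * p + 2, by omega⟩ ⟨4 * p + 1, by omega⟩ (by simp) (by simp)
  have h3 := key ⟨4 * p, by omega⟩ ⟨4 * p + 3, by omega⟩ (by simp) (by simp)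
  have h4 := key ⟨4 * p + 2, by omega⟩ ⟨4 * p + 3, by omega⟩ (by simp) (by simp)
  simp at h1 h2 h3 h4
  generalize z (Sum.inl l) = t at *
  generalize z (Sum.inl _) = a at *
  generalize z (Sum.inl _) = b at *
  generalize z (Sum.inl _) = c at *
  generalize z (Sum.inl _) = d at *
  clear hcon key
  revert t a b c d
  decide

lemma far_dist (k : ℕ) (hk : 37 ≤ k) (z : Coord k → ZMod 2) (hz : IsCodeword k z) :
    2 * k < hammingDist (farY k) z := by
  have h := fun q : Fin 3 × Fin (k - 12) =>
    exists_bad k z hz q.1.val q.1.isLt ⟨q.2.val + 12, by omega⟩ (by simp)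
  choose g hg1 hg2 hg3 hg4 using h
  have hinj : Function.Injective g := by
    intro q r hqr
    have e1 : q.2.val = r.2.val := by
      by_contra hne
      have a1 := hg3 r _ (hqr ▸ hg2 q) (by simp [Fin.ext_iff]; omega)
      have := r.1.isLt
      simp only at a1
      omega
    have e2 : q.1.val = r.1.val := by
      obtain ⟨a, ha, hne⟩ := hg4 q
      have a1 := hg3 q a ha hne
      have a2 := hg3 r a (hqr ▸ ha) (by simpa [e1] using hne)
      omega
    exact Prod.ext (Fin.ext e1 |> fun _ => Fin.ext e2) (Fin.ext e1)
  have hcard : (Finset.univ : Finset (Fin 3 × Fin (k - 12))).card ≤ hammingDist (farY k) z := by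
    unfold hammingDist
    let f : Fin 3 × Fin (k - 12) → Coord k := fun q => Sum.inr (g q)
    have hf : ∀ q, farY k (f q) ≠ z (f q) := hg1
    apply Finset.card_le_card_of_injOn f
    · intro q _
      rw [Finset.mem_coe, Finset.mem_filter]
      exact ⟨Finset.mem_univ _, hf q⟩
    · intro q _ r _ h
      exact hinj (Sum.inr.inj h)
  simp at hcard
  omega

theorem stmt4 : ∃ k0 : ℕ, ∀ k : ℕ, k0 ≤ k →
    ∃ y : Coord k → ZMod 2, ∀ x : Coord k → ZMod 2,
      Huang k x → ¬ Huang k (x + y) := by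
  refine ⟨37, fun k hk => ⟨farY k, ?_⟩⟩
  rintro x ⟨c, hc, hxc⟩ ⟨d, hd, hxd⟩
  have hz : IsCodeword k (d - c) := by
    intro A
    have h1 : d (Sum.inr A) - c (Sum.inr A) =
        ∑ a ∈ A.1, (d (Sum.inl a) - c (Sum.inl a)) := by
      rw [Finset.sum_sub_distrib, hc A, hd A]
    exact h1
  have h := far_dist k hk _ hz
  have e : hammingDist (farY k) (d - c) = hammingDist (x + farY k) (d + (x - c)) := by
    unfold hammingDist
    congr 1
    ext i
    simp only [Finset.mem_filter, Finset.mem_univ, true_and, Pi.sub_apply, Pi.add_apply]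
    apply not_congr
    constructor <;> intro h
    · rw [h]; ring
    · linear_combination h
  have e2 : hammingDist d (d + (x - c)) = hammingDist x c := by
    unfold hammingDist
    congr 1
    ext i
    simp only [Finset.mem_filter, Finset.mem_univ, true_and, Pi.sub_apply, Pi.add_apply]
    apply not_congr
    constructor <;> intro h
    · linear_combination -h
    · rw [h]; ring
  have t := hammingDist_triangle (x + farY k) d (d + (x - c))
  omega
end

section
/- For every integer k ≥ 1, the 0-variability of Huang's predicate H_k is at least k. Concretely: for every set S of coordinates of {0,1}^K with |S| ≤ k − 1 (where K = k + C(k,3)) and every assignment σ : S → {0,1}, there exists x ∈ {0,1}^K that agrees with σ on S and satisfies H_k(x) = 1. -/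
/-- For every `k ≥ 1`, the 0-variability of Huang's predicate `H_k`
is at least `k`: for every set `S` of at most `k - 1` coordinates and every assignment
`σ` to those coordinates, there exists `x` agreeing with `σ` on `S` with `H_k(x) = 1`. -/
theorem stmt5 (k : ℕ) (hk : 1 ≤ k) (S : Finset (Coord k)) (hS : S.card ≤ k - 1)
    (σ : Coord k → ZMod 2) :
    ∃ x : Coord k → ZMod 2, (∀ i ∈ S, x i = σ i) ∧ Huang k x := by
  refine ⟨fun i => if i ∈ S then σ i else 0, fun i hi => if_pos hi, fun _ => 0, ?_, ?_⟩
  · intro A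
    simp
  · refine le_trans (Finset.card_le_card (t := S) ?_) (by omega)
    intro i hi
    by_contra h
    simp [h] at hi
end

section
/- Let K = 2t+1 ≥ 3 be odd. Then 1 − 1/(K+1) is the maximum, over all pairwise uniform probability distributions D on {0,1}^K, of the probability under D that maj_K(x) = 1. That is: (i) there exists a pairwise uniform distribution D on {0,1}^K with Pr_{x~D}(maj_K(x)=1) = 1 − 1/(K+1), namely the distribution that with probability 1/(2t+2) outputs the all-zeros vector and with probability (2t+1)/(2t+2) outputs a uniformly random vector with exactly t+1 ones; and (ii) every pairwise uniform distribution D on {0,1}^K satisfies Pr_{x~D}(maj_K(x)=1) ≤ 1 − 1/(K+1). -/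
/-- A probability distribution on `{0,1}^ι` (given by its weight function `p`) is
pairwise uniform if for every pair of distinct coordinates `i ≠ j` and all values
`a, b ∈ {0,1}`, the probability that `(x i, x j) = (a, b)` equals `1/4`. -/
def PairwiseUniform {ι : Type*} [Fintype ι] [DecidableEq ι]
    (p : (ι → Bool) → ℝ) : Prop :=
  ∀ i j : ι, i ≠ j → ∀ a b : Bool,
    ∑ x ∈ Finset.univ.filter (fun x : ι → Bool => x i = a ∧ x j = b), p x = 1 / 4

/-- `p` is (the weight function of) a probability distribution. -/
def IsDist {ι : Type*} [Fintype ι] [DecidableEq ι] (p : (ι → Bool) → ℝ) : Prop :=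
  (∀ x, 0 ≤ p x) ∧ ∑ x : ι → Bool, p x = 1

/-- The number of coordinates of `x` equal to `1`. -/
def ones {ι : Type*} [Fintype ι] [DecidableEq ι] (x : ι → Bool) : ℕ :=
  (Finset.univ.filter (fun i => x i = true)).card


noncomputable def bitVal {n : ℕ} (x : Fin n → Bool) (i : Fin n) : ℝ := if x i = true then 1 else 0

lemma ones_eq_sum {n : ℕ} (x : Fin n → Bool) : (ones x : ℝ) = ∑ i, bitVal x i := by
  simp [ones, bitVal]

lemma ones_perm {n : ℕ} (x : Fin n → Bool) (σ : Equiv.Perm (Fin n)) :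
    ones (fun i => x (σ i)) = ones x := by
  have h : (ones (fun i => x (σ i)) : ℝ) = ones x := by
    rw [ones_eq_sum, ones_eq_sum]
    exact Equiv.sum_comp σ (fun i => bitVal x i)
  exact_mod_cast h

lemma sum_perm {n : ℕ} (σ : Equiv.Perm (Fin n)) (g : (Fin n → Bool) → ℝ) :
    ∑ x : Fin n → Bool, g (fun i => x (σ i)) = ∑ x, g x := by
  refine Fintype.sum_equiv (Equiv.arrowCongr σ.symm (Equiv.refl Bool)) _ _ ?_
  intro x
  rfl

lemma card_ones (n k : ℕ) :
    (Finset.univ.filter (fun x : Fin n → Bool => ones x = k)).card = n.choose k := by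
  have h : (Finset.powersetCard k (Finset.univ : Finset (Fin n))).card = n.choose k := by
    simp
  rw [← h]
  refine Finset.card_nbij' (fun x => Finset.univ.filter (fun i => x i = true))
    (fun s i => decide (i ∈ s)) ?_ ?_ ?_ ?_
  · intro x hx
    have hx' : ones x = k := (Finset.mem_filter.mp hx).2
    exact Finset.mem_powersetCard.mpr ⟨Finset.subset_univ _, hx'⟩
  · intro s hs
    have hs' : s.card = k := (Finset.mem_powersetCard.mp hs).2
    refine Finset.mem_filter.mpr ⟨Finset.mem_univ _, ?_⟩
    simpa [ones] using hs'
  · intro x hx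
    ext i
    simp
  · intro s hs
    ext i
    simp

lemma pair_of_moments {n : ℕ} (p : (Fin n → Bool) → ℝ) (h0 : ∑ x, p x = 1)
    (h1 : ∀ i, ∑ x, p x * bitVal x i = 1 / 2)
    (h2 : ∀ i j, i ≠ j → ∑ x, p x * bitVal x i * bitVal x j = 1 / 4) :
    PairwiseUniform p := by
  intro i j hij a b
  have hi := h1 i
  have hj := h1 j
  have h := h2 i j hij
  rw [Finset.sum_filter]
  cases a <;> cases b
  · have e : ∀ x : Fin n → Bool, (if x i = false ∧ x j = false then p x else 0)
        = p x - p x * bitVal x i - p x * bitVal x j + p x * bitVal x i * bitVal x j := by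
      intro x
      unfold bitVal
      cases x i <;> cases x j <;> simp
    simp only [e, Finset.sum_add_distrib, Finset.sum_sub_distrib, h0, hi, hj, h]
    norm_num
  · have e : ∀ x : Fin n → Bool, (if x i = false ∧ x j = true then p x else 0)
        = p x * bitVal x j - p x * bitVal x i * bitVal x j := by
      intro x
      unfold bitVal
      cases x i <;> cases x j <;> simp
    simp only [e, Finset.sum_sub_distrib, hj, h]
    norm_num
  · have e : ∀ x : Fin n → Bool, (if x i = true ∧ x j = false then p x else 0)
        = p x * bitVal x i - p x * bitVal x i * bitVal x j := by
      intro x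
      unfold bitVal
      cases x i <;> cases x j <;> simp
    simp only [e, Finset.sum_sub_distrib, hi, h]
    norm_num
  · have e : ∀ x : Fin n → Bool, (if x i = true ∧ x j = true then p x else 0)
        = p x * bitVal x i * bitVal x j := by
      intro x
      unfold bitVal
      cases x i <;> cases x j <;> simp
    simp only [e, h]

lemma moment_of_pair {n : ℕ} (p : (Fin n → Bool) → ℝ) (hp : PairwiseUniform p)
    (i j : Fin n) (hij : i ≠ j) : ∑ x, p x * bitVal x i = 1 / 2 := by
  have ha := hp i j hij true true
  have hb := hp i j hij true false
  rw [Finset.sum_filter] at ha hb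
  have e : ∀ x : Fin n → Bool, p x * bitVal x i =
      (if x i = true ∧ x j = true then p x else 0)
        + (if x i = true ∧ x j = false then p x else 0) := by
    intro x
    unfold bitVal
    cases x i <;> cases x j <;> simp
  simp only [e, Finset.sum_add_distrib, ha, hb]
  norm_num

lemma upper (t : ℕ) (ht : 1 ≤ t) (p : (Fin (2 * t + 1) → Bool) → ℝ) (hd : IsDist p)
    (hp : PairwiseUniform p) :
    ∑ x ∈ Finset.univ.filter (fun x : Fin (2 * t + 1) → Bool => t + 1 ≤ ones x), p x
        ≤ 1 - 1 / (2 * (t : ℝ) + 2) := by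
  have : Nontrivial (Fin (2 * t + 1)) := Fin.nontrivial_iff_two_le.mpr (by omega)
  have hm : ∀ i, ∑ x, p x * bitVal x i = 1 / 2 := fun i => by
    obtain ⟨j, hj⟩ := exists_ne i
    exact moment_of_pair p hp i j hj.symm
  have hS : ∑ x, p x * (ones x : ℝ) = (2 * t + 1) / 2 := by
    simp only [ones_eq_sum, Finset.mul_sum]
    rw [Finset.sum_comm]
    simp only [hm]
    simp
    ring
  have hle : (t + 1 : ℝ) * ∑ x ∈ Finset.univ.filter
      (fun x : Fin (2 * t + 1) → Bool => t + 1 ≤ ones x), p x ≤ ∑ x, p x * (ones x : ℝ) := by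
    rw [Finset.sum_filter, Finset.mul_sum]
    refine Finset.sum_le_sum fun x _ => ?_
    have h0 := hd.1 x
    split_ifs with h
    · have : (t + 1 : ℝ) ≤ ones x := by exact_mod_cast h
      nlinarith
    · simp only [mul_zero]
      positivity
  rw [hS] at hle
  have e : 1 - 1 / (2 * (t : ℝ) + 2) = (2 * t + 1) / 2 / (t + 1) := by
    field_simp
    ring
  rw [e, le_div_iff₀ (by positivity)]
  linarith

/-- Let `K = 2t+1 ≥ 3` be odd.  Then `1 - 1/(K+1)` is the maximum,
over all pairwise uniform distributions `D` on `{0,1}^K`, of `Pr_{x~D}(maj_K x = 1)`: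
(i) the distribution giving weight `1/(2t+2)` to the all-zeros vector and distributing
the remaining mass `(2t+1)/(2t+2)` uniformly over the vectors with exactly `t+1` ones
is pairwise uniform and gives majority-probability exactly `1 - 1/(K+1)`; and
(ii) every pairwise uniform distribution `D` satisfies
`Pr_{x~D}(maj_K x = 1) ≤ 1 - 1/(K+1)`. -/
theorem stmt6 (t : ℕ) (ht : 1 ≤ t) :
    (∃ p : (Fin (2 * t + 1) → Bool) → ℝ,
      (p = fun x => if (∀ i, x i = false) then 1 / (2 * (t : ℝ) + 2)
            else if ones x = t + 1 then
              ((2 * (t : ℝ) + 1) / (2 * (t : ℝ) + 2)) / ((2 * t + 1).choose (t + 1) : ℝ)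
            else 0) ∧
      IsDist p ∧ PairwiseUniform p ∧
      ∑ x ∈ Finset.univ.filter (fun x : Fin (2 * t + 1) → Bool => t + 1 ≤ ones x), p x
        = 1 - 1 / (2 * (t : ℝ) + 2)) ∧
    (∀ p : (Fin (2 * t + 1) → Bool) → ℝ, IsDist p → PairwiseUniform p →
      ∑ x ∈ Finset.univ.filter (fun x : Fin (2 * t + 1) → Bool => t + 1 ≤ ones x), p x
        ≤ 1 - 1 / (2 * (t : ℝ) + 2)) := by
  refine ⟨⟨_, rfl, ?_⟩, upper t ht⟩
  set p : (Fin (2 * t + 1) → Bool) → ℝ := fun x => if (∀ i, x i = false) then 1 / (2 * (t : ℝ) + 2)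
            else if ones x = t + 1 then
              ((2 * (t : ℝ) + 1) / (2 * (t : ℝ) + 2)) / ((2 * t + 1).choose (t + 1) : ℝ)
            else 0 with hpdef
  have hz : ∀ x : Fin (2 * t + 1) → Bool, (∀ i, x i = false) → ones x = 0 := by
    intro x hx
    simp [ones, hx]
  have hC : (0 : ℝ) < ((2 * t + 1).choose (t + 1) : ℝ) := by
    exact_mod_cast Nat.choose_pos (by omega)
  have hpos : ∀ x, 0 ≤ p x := by
    intro x
    simp only [hpdef]
    split_ifs <;> positivity
  have hM : ∑ x ∈ Finset.univ.filter (fun x : Fin (2 * t + 1) → Bool => t + 1 ≤ ones x), p x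
      = (2 * (t : ℝ) + 1) / (2 * (t : ℝ) + 2) := by
    have e : ∀ x : Fin (2 * t + 1) → Bool, (if t + 1 ≤ ones x then p x else 0) =
        if ones x = t + 1 then
          ((2 * (t : ℝ) + 1) / (2 * (t : ℝ) + 2)) / ((2 * t + 1).choose (t + 1) : ℝ) else 0 := by
      intro x
      simp only [hpdef]
      by_cases hx : ∀ i, x i = false
      · simp [hz x hx]
      · by_cases h1 : ones x = t + 1
        · rw [if_neg hx, if_pos h1, if_pos h1.ge]
        · simp [hx, h1]
    rw [Finset.sum_filter]
    simp only [e]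
    rw [← Finset.sum_filter, Finset.sum_const, card_ones, nsmul_eq_mul]
    field_simp
  have hL : ∑ x ∈ Finset.univ.filter (fun x : Fin (2 * t + 1) → Bool => ¬ t + 1 ≤ ones x), p x
      = 1 / (2 * (t : ℝ) + 2) := by
    have e : ∀ x : Fin (2 * t + 1) → Bool, (if ¬ t + 1 ≤ ones x then p x else 0) =
        if x = (fun _ => false) then 1 / (2 * (t : ℝ) + 2) else 0 := by
      intro x
      simp only [hpdef]
      by_cases hx : ∀ i, x i = false
      · have hx' : x = fun _ => false := funext hx
        rw [if_pos hx, if_pos hx', hz x hx]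
        simp
      · have hx' : ¬ x = fun _ => false := fun h => hx (fun i => by rw [h])
        rw [if_neg hx, if_neg hx']
        split_ifs <;> first | rfl | omega
    rw [Finset.sum_filter]
    simp only [e]
    simp
  have h0 : ∑ x, p x = 1 := by
    rw [← Finset.sum_filter_add_sum_filter_not Finset.univ
      (fun x : Fin (2 * t + 1) → Bool => t + 1 ≤ ones x), hM, hL]
    field_simp
    ring
  have hsymm : ∀ (σ : Equiv.Perm (Fin (2 * t + 1))) x, p (fun i => x (σ i)) = p x := by
    intro σ x
    simp only [hpdef, ones_perm]
    have : (∀ i, x (σ i) = false) ↔ ∀ i, x i = false :=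
      ⟨fun h i => by simpa using h (σ.symm i), fun h i => h _⟩
    simp only [this]
  have hones : ∀ x, p x * (ones x : ℝ) = (t + 1) * if t + 1 ≤ ones x then p x else 0 := by
    intro x
    simp only [hpdef]
    by_cases hx : ∀ i, x i = false
    · simp [hz x hx]
    · by_cases h1 : ones x = t + 1
      · rw [if_neg hx, if_pos h1, if_pos h1.ge, h1]
        push_cast
        ring
      · simp [hx, h1]
  have hT : (0 : ℝ) < t := by exact_mod_cast ht
  have h1 : ∀ i, ∑ x, p x * bitVal x i = 1 / 2 := by
    intro i
    have hs : ∀ j, ∑ x, p x * bitVal x j = ∑ x, p x * bitVal x i := by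
      intro j
      rw [← sum_perm (Equiv.swap i j) (fun x => p x * bitVal x j)]
      simp only [hsymm, bitVal, Equiv.swap_apply_right]
    have hS : ∑ j, ∑ x, p x * bitVal x j = (2 * t + 1) / 2 := by
      rw [Finset.sum_comm]
      simp only [← Finset.mul_sum, ← ones_eq_sum, hones]
      rw [← Finset.sum_filter, hM]
      field_simp
    simp only [hs] at hS
    rw [Finset.sum_const, Finset.card_univ, Fintype.card_fin, nsmul_eq_mul] at hS
    push_cast at hS
    have : (2 * (t : ℝ) + 1) * (∑ x, p x * bitVal x i - 1 / 2) = 0 := by linarith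
    rcases mul_eq_zero.mp this with h | h <;> linarith
  have h2 : ∀ i j, i ≠ j → ∑ x, p x * bitVal x i * bitVal x j = 1 / 4 := by
    intro i j hij
    have hs : ∀ k ∈ Finset.univ.erase i,
        ∑ x, p x * bitVal x i * bitVal x k = ∑ x, p x * bitVal x i * bitVal x j := by
      intro k hk
      have hk' : i ≠ k := (Finset.ne_of_mem_erase hk).symm
      rw [← sum_perm (Equiv.swap j k) (fun x => p x * bitVal x i * bitVal x k)]
      simp only [hsymm, bitVal, Equiv.swap_apply_right, Equiv.swap_apply_of_ne_of_ne hij hk']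
    have hS : ∑ k, ∑ x, p x * bitVal x i * bitVal x k = (t + 1) / 2 := by
      rw [Finset.sum_comm]
      simp only [← Finset.mul_sum, ← ones_eq_sum]
      have e : ∀ x, p x * bitVal x i * (ones x : ℝ) = (t + 1) * (p x * bitVal x i) := by
        intro x
        by_cases hx : ∀ i, x i = false
        · simp [bitVal, hx]
        · by_cases h1 : ones x = t + 1
          · rw [h1]
            push_cast
            ring
          · simp [hpdef, hx, h1]
      simp only [e]
      rw [← Finset.mul_sum, h1]
      ring
    have hd : ∑ x, p x * bitVal x i * bitVal x i = 1 / 2 := by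
      rw [← h1 i]
      refine Finset.sum_congr rfl fun x _ => ?_
      unfold bitVal
      split_ifs <;> simp
    rw [← Finset.add_sum_erase _ _ (Finset.mem_univ i), hd, Finset.sum_congr rfl hs,
      Finset.sum_const, Finset.card_erase_of_mem (Finset.mem_univ i), Finset.card_univ,
      Fintype.card_fin, nsmul_eq_mul, Nat.add_sub_cancel] at hS
    push_cast at hS
    have : (t : ℝ) * (∑ x, p x * bitVal x i * bitVal x j - 1 / 4) = 0 := by linarith
    rcases mul_eq_zero.mp this with h | h <;> linarith
  refine ⟨⟨hpos, h0⟩, pair_of_moments p h0 h1 h2, ?_⟩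
  rw [hM]
  field_simp
  ring
end

section
/- There exists a random variable Z = (Z_1, Z_2, Z_3, Z_4) taking values in {0,1}^4 such that: (i) the coordinates Z_1,...,Z_4 are pairwise independent, i.e., for all distinct i,j and all a,b ∈ {0,1}, Pr(Z_i = a and Z_j = b) = Pr(Z_i = a)·Pr(Z_j = b); (ii) Pr(Z_i = 1) = 3/8 for every i ∈ {1,2,3,4}; and (iii) Pr(Z = (0,0,0,0)) = 0. -/
/-- Weights (in units of 1/64), depending only on the number of ones. -/
def wt (x : Fin 4 → Bool) : ℕ :=
  match (x 0).toNat + (x 1).toNat + (x 2).toNat + (x 3).toNat with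
  | 0 => 0
  | 1 => 12
  | 2 => 1
  | 3 => 1
  | _ => 6

theorem wt_total : ∑ x : Fin 4 → Bool, wt x = 64 := by decide +kernel

theorem wt_single : ∀ (i : Fin 4) (a : Bool),
    ∑ x ∈ Finset.univ.filter (fun x : Fin 4 → Bool => x i = a), wt x
      = if a then 24 else 40 := by decide +kernel

theorem wt_pair : ∀ i j : Fin 4, i ≠ j → ∀ a b : Bool,
    64 * ∑ x ∈ Finset.univ.filter (fun x : Fin 4 → Bool => x i = a ∧ x j = b), wt x
      = (if a then 24 else 40) * (if b then 24 else 40) := by decide +kernel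

/-- There exists a distribution `Z = (Z_1,…,Z_4)` on `{0,1}^4` whose
coordinates are pairwise independent, with `Pr(Z_i = 1) = 3/8` for each `i`, and with
`Pr(Z = (0,0,0,0)) = 0`. -/
theorem stmt9 :
    ∃ p : (Fin 4 → Bool) → ℝ, IsDist p ∧
      (∀ i j : Fin 4, i ≠ j → ∀ a b : Bool,
        ∑ x ∈ Finset.univ.filter (fun x : Fin 4 → Bool => x i = a ∧ x j = b), p x
          = (∑ x ∈ Finset.univ.filter (fun x : Fin 4 → Bool => x i = a), p x) *
            (∑ x ∈ Finset.univ.filter (fun x : Fin 4 → Bool => x j = b), p x)) ∧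
      (∀ i : Fin 4,
        ∑ x ∈ Finset.univ.filter (fun x : Fin 4 → Bool => x i = true), p x = 3 / 8) ∧
      p (fun _ => false) = 0 := by
  have key : ∀ s : Finset (Fin 4 → Bool),
      ∑ x ∈ s, ((wt x : ℝ) / 64) = ((∑ x ∈ s, wt x : ℕ) : ℝ) / 64 := by
    intro s
    rw [Nat.cast_sum, Finset.sum_div]
  refine ⟨fun x => (wt x : ℝ) / 64, ⟨fun x => by positivity, ?_⟩, ?_, ?_, ?_⟩
  · rw [key, wt_total]
    norm_num
  · intro i j hij a b
    have h := congrArg (Nat.cast : ℕ → ℝ) (wt_pair i j hij a b)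
    rw [key, key, key, wt_single, wt_single]
    rw [Nat.cast_mul, Nat.cast_mul] at h
    push_cast at h ⊢
    linarith
  · intro i
    rw [key, wt_single]
    norm_num
  · simp [wt]
end

section
/- Let k = 2t+1 ≥ 3 be odd. The probability distribution D_k on {0,1}^k that with probability 1/(k+1) outputs the all-ones vector and with probability k/(k+1) outputs a uniformly random vector with exactly t ones is pairwise uniform, and its support is contained in the set {x ∈ {0,1}^k : x has at least t ones}, i.e., in T_{k,t}^{-1}(1). -/
/-- Number of vectors with two prescribed coordinates and a prescribed number of ones. -/
lemma count_aux (N : ℕ) (i j : Fin N) (hij : i ≠ j) (a b : Bool) (m n : ℕ)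
    (hmn : m + a.toNat + b.toNat = n) :
    (Finset.univ.filter (fun x : Fin N → Bool => (x i = a ∧ x j = b) ∧ ones x = n)).card
      = (N - 2).choose m := by
  classical
  have hc : ((Finset.univ : Finset (Fin N)) \ {i, j}).card = N - 2 := by
    rw [Finset.card_sdiff_of_subset (Finset.subset_univ _), Finset.card_pair hij]; simp
  have key : ∀ x : Fin N → Bool,
      ones x = ((Finset.univ \ {i, j}).filter (fun l => x l = true)).card
        + (x i).toNat + (x j).toNat := by
    intro x
    have h1 : Finset.univ.filter (fun l => x l = true)
        = ((Finset.univ \ {i, j}).filter (fun l => x l = true))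
          ∪ (({i, j} : Finset (Fin N)).filter (fun l => x l = true)) := by
      rw [← Finset.filter_union]
      congr 1
      exact (Finset.sdiff_union_of_subset (Finset.subset_univ _)).symm
    have h2 : Disjoint ((Finset.univ \ {i, j}).filter (fun l => x l = true))
          (({i, j} : Finset (Fin N)).filter (fun l => x l = true)) :=
      Finset.disjoint_filter_filter Finset.sdiff_disjoint
    unfold ones
    rw [h1, Finset.card_union_of_disjoint h2, add_assoc]
    congr 1
    rw [Finset.filter_insert, Finset.filter_singleton]
    cases hi : x i <;> cases hj : x j <;> simp [hij]
  rw [← hc, ← Finset.card_powersetCard]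
  refine Finset.card_bij' (fun x _ => (Finset.univ \ {i, j}).filter (fun l => x l = true))
    (fun s _ l => if l = i then a else if l = j then b else decide (l ∈ s)) ?_ ?_ ?_ ?_
  · intro x hx
    simp only [Finset.mem_filter, Finset.mem_univ, true_and] at hx
    obtain ⟨⟨h1, h2⟩, h3⟩ := hx
    rw [Finset.mem_powersetCard]
    refine ⟨Finset.filter_subset _ _, ?_⟩
    have := key x
    rw [h1, h2] at this
    omega
  · intro s hs
    rw [Finset.mem_powersetCard] at hs
    simp only [Finset.mem_filter, Finset.mem_univ, true_and]
    refine ⟨⟨by simp, by simp [hij.symm]⟩, ?_⟩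
    rw [key]
    have : (Finset.univ \ {i, j}).filter (fun l => (if l = i then a else if l = j then b
        else decide (l ∈ s)) = true) = s := by
      ext l
      have := @hs.1 l
      simp only [Finset.mem_filter, Finset.mem_sdiff, Finset.mem_univ, true_and,
        Finset.mem_insert, Finset.mem_singleton, not_or] at this ⊢
      constructor
      · rintro ⟨⟨h1, h2⟩, h3⟩
        simpa [h1, h2] using h3
      · intro h
        have hmem := this h
        exact ⟨hmem, by simp [hmem.1, hmem.2, h]⟩
    rw [this, hs.2]
    simp [hij.symm, hmn]
  · intro x hx
    simp only [Finset.mem_filter, Finset.mem_univ, true_and] at hx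
    obtain ⟨⟨h1, h2⟩, h3⟩ := hx
    funext l
    by_cases hi : l = i
    · subst hi; simp [h1]
    · by_cases hj : l = j
      · subst hj; simp [hi, h2]
      · simp [hi, hj]
  · intro s hs
    rw [Finset.mem_powersetCard] at hs
    ext l
    have := @hs.1 l
    simp only [Finset.mem_filter, Finset.mem_sdiff, Finset.mem_univ, true_and,
      Finset.mem_insert, Finset.mem_singleton, not_or] at this ⊢
    constructor
    · rintro ⟨⟨h1, h2⟩, h3⟩
      simpa [h1, h2] using h3
    · intro h
      have hmem := this h
      exact ⟨hmem, by simp [hmem.1, hmem.2, h]⟩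

/-- The count with both coordinates equal to one, relative to the mixed count. -/
lemma count_tt (s : ℕ) (i j : Fin (2 * (s + 1) + 1)) (hij : i ≠ j) :
    (Finset.univ.filter (fun x : Fin (2 * (s + 1) + 1) → Bool =>
      (x i = true ∧ x j = true) ∧ ones x = s + 1)).card * (s + 2)
      = s * (2 * s + 1).choose s := by
  rcases s with _ | r
  · simp only [zero_mul, Nat.mul_eq_zero, Finset.card_eq_zero]
    left
    rw [Finset.filter_eq_empty_iff]
    rintro x - ⟨⟨h1, h2⟩, h3⟩
    have : ({i, j} : Finset _).card ≤ ones x := by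
      apply Finset.card_le_card
      intro l hl
      simp only [Finset.mem_insert, Finset.mem_singleton] at hl
      rcases hl with rfl | rfl <;> simp [h1, h2]
    rw [Finset.card_pair hij] at this
    omega
  · rw [count_aux _ i j hij true true r _ (by simp)]
    have h := Nat.choose_succ_right_eq (2 * (r + 1) + 1) r
    have e : 2 * (r + 1) + 1 - r = r + 1 + 2 := by omega
    have e' : 2 * (r + 1 + 1) + 1 - 2 = 2 * (r + 1) + 1 := by omega
    rw [e] at h
    rw [e', ← h, mul_comm]

lemma choose_rel (s : ℕ) :
    (2 * (s + 1) + 1).choose (s + 1) * (s + 2) = (2 * s + 1).choose s * (2 * (2 * s + 3)) := by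
  have h1 := Nat.add_one_mul_choose_eq (2 * s + 2) s
  have h2 := Nat.choose_succ_right_eq (2 * s + 2) s
  have h3 := Nat.add_one_mul_choose_eq (2 * s + 1) s
  have e : 2 * s + 2 - s = s + 2 := by omega
  rw [e] at h2
  have e2 : 2 * (s + 1) + 1 = 2 * s + 2 + 1 := by ring
  rw [e2]
  have : (s + 1) * ((2 * s + 2 + 1).choose (s + 1) * (s + 2))
      = (s + 1) * ((2 * s + 1).choose s * (2 * (2 * s + 3))) := by
    zify at *
    linear_combination (-(s : ℤ) - 2) * h1 - (2 * s + 3) * h2 - (2 * s + 3) * h3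
  exact Nat.eq_of_mul_eq_mul_left (by omega) this

/-- Let `k = 2t+1 ≥ 3` be odd.  The distribution `D_k` on `{0,1}^k`
that with probability `1/(k+1)` outputs the all-ones vector and with probability
`k/(k+1)` outputs a uniformly random vector with exactly `t` ones, is pairwise uniform
and is supported inside `T_{k,t}⁻¹(1) = {x : x has at least t ones}`. -/
theorem stmt10 (t : ℕ) (ht : 1 ≤ t)
    (p : (Fin (2 * t + 1) → Bool) → ℝ)
    (hp : p = fun x => if (∀ i, x i = true) then 1 / (2 * (t : ℝ) + 2)
          else if ones x = t then
            ((2 * (t : ℝ) + 1) / (2 * (t : ℝ) + 2)) / ((2 * t + 1).choose t : ℝ)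
          else 0) :
    PairwiseUniform p ∧ ∀ x : Fin (2 * t + 1) → Bool, p x ≠ 0 → t ≤ ones x := by
  subst hp
  obtain ⟨s, rfl⟩ : ∃ s, t = s + 1 := ⟨t - 1, by omega⟩
  have hall : ∀ x : Fin (2 * (s + 1) + 1) → Bool, (∀ i, x i = true) →
      ones x = 2 * (s + 1) + 1 := by
    intro x hx
    simp [ones, hx]
  constructor
  · intro i j hij a b
    have hsplit : ∀ c d : ℝ, ∀ x : Fin (2 * (s + 1) + 1) → Bool,
        (if (∀ i, x i = true) then c else if ones x = s + 1 then d else 0)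
          = (if x = (fun _ => true) then c else 0) + (if ones x = s + 1 then d else 0) := by
      intro c d x
      by_cases h : ∀ i, x i = true
      · have h1 := hall x h
        have h2 : x = fun _ => true := funext h
        rw [if_pos h, if_pos h2, if_neg (by omega), add_zero]
      · have h2 : ¬ x = fun _ => true := fun h' => h (congrFun h')
        rw [if_neg h, if_neg h2, zero_add]
    simp only [hsplit]
    rw [Finset.sum_add_distrib, Finset.sum_ite_eq', ← Finset.sum_filter, Finset.sum_const,
      Finset.filter_filter, nsmul_eq_mul]
    have hC := choose_rel s
    have hpos : 0 < (2 * (s + 1) + 1).choose (s + 1) := Nat.choose_pos (by omega)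
    have hA : 0 < (2 * s + 1).choose s := Nat.choose_pos (by omega)
    have hT := count_tt s i j hij
    have hsym : (2 * s + 1).choose (s + 1) = (2 * s + 1).choose s := Nat.choose_symm_half s
    have e' : 2 * (s + 1) + 1 - 2 = 2 * s + 1 := by omega
    have hmix : ∀ n : ℕ, n = (2 * s + 1).choose s →
        (n : ℝ) * (((2 * ((s + 1 : ℕ) : ℝ) + 1) / (2 * ((s + 1 : ℕ) : ℝ) + 2)) /
          ((2 * (s + 1) + 1).choose (s + 1) : ℝ)) = 1 / 4 := by
      rintro n rfl
      have hC' : (((2 * (s + 1) + 1).choose (s + 1) : ℕ) : ℝ) * (s + 2)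
        = ((2 * s + 1).choose s : ℕ) * (2 * (2 * s + 3)) := by exact_mod_cast hC
      have hpos' : (0 : ℝ) < ((2 * (s + 1) + 1).choose (s + 1) : ℕ) := by exact_mod_cast hpos
      generalize (((2 * (s + 1) + 1).choose (s + 1) : ℕ) : ℝ) = C at *
      generalize (((2 * s + 1).choose s : ℕ) : ℝ) = A at *
      push_cast
      have : (0 : ℝ) < 2 * (s + 1) + 2 := by positivity
      field_simp
      linear_combination -2 * hC'
    cases a <;> cases b
    · rw [hmix _ (by rw [count_aux _ i j hij false false (s + 1) _ (by simp), e', hsym])]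
      simp
    · rw [hmix _ (by rw [count_aux _ i j hij false true s _ (by simp), e'])]
      simp
    · rw [hmix _ (by rw [count_aux _ i j hij true false s _ (by simp), e'])]
      simp
    · have h4 := hmix _ rfl
      rw [if_pos (by simp)]
      have hT' : (((Finset.univ.filter (fun x : Fin (2 * (s + 1) + 1) → Bool =>
        (x i = true ∧ x j = true) ∧ ones x = s + 1)).card : ℕ) : ℝ)
          = s / (s + 2) * ((2 * s + 1).choose s : ℕ) := by
        have : (0 : ℝ) < s + 2 := by positivity
        field_simp
        exact_mod_cast hT
      rw [hT', mul_assoc, h4]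
      push_cast
      have : (0 : ℝ) < s + 2 := by positivity
      have : (0 : ℝ) < 2 * (s + 1) + 2 := by positivity
      field_simp
      ring
  · intro x hx
    by_cases h : ∀ i, x i = true
    · rw [hall x h]; omega
    · by_contra h'
      apply hx
      have : ones x ≠ s + 1 := by omega
      simp only [if_neg h, if_neg this]
end

section
/- There exists k_0 such that for every integer k ≥ k_0 the following holds. There exists a pairwise uniform probability distribution D on ({0,1}^k)^4 (viewed as a distribution on {0,1}^{4k}, pairwise uniform with respect to all 4k coordinates) whose support is contained in the set of tuples (x^1, x^2, x^3, x^4) such that at least one block x^j has fewer than ⌈k/2⌉ − 1 coordinates equal to 1. -/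
namespace Aux

/-- The sign of a bit. -/
def chi (b : Bool) : ℝ := if b then 1 else -1

lemma chi_sq (b : Bool) : chi b * chi b = 1 := by cases b <;> simp [chi]

/-- Vectors with exactly `S` ones. -/
def slice (k S : ℕ) : Finset (Fin k → Bool) :=
  Finset.univ.filter (fun x => (Finset.univ.filter (fun i => x i = true)).card = S)

lemma slice_nonempty {k S : ℕ} (h : S ≤ k) : (slice k S).Nonempty := by
  obtain ⟨t, _, ht⟩ := Finset.exists_subset_card_eq
    (s := (Finset.univ : Finset (Fin k))) (n := S) (by simpa using h)
  refine ⟨fun i => decide (i ∈ t), ?_⟩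
  simp [slice, ht]

/-- Uniform weight on the slice. -/
noncomputable def U (k S : ℕ) (x : Fin k → Bool) : ℝ :=
  if x ∈ slice k S then ((slice k S).card : ℝ)⁻¹ else 0

lemma U_nonneg (k S : ℕ) (x : Fin k → Bool) : 0 ≤ U k S x := by
  unfold U; split_ifs <;> positivity

lemma U_sum {k S : ℕ} (h : S ≤ k) : ∑ x, U k S x = 1 := by
  have := (slice_nonempty h).card_pos
  simp only [U, Finset.sum_ite_mem, Finset.univ_inter, Finset.sum_const, nsmul_eq_mul]
  apply mul_inv_cancel₀
  positivity

lemma U_supp {k S : ℕ} {x : Fin k → Bool} (h : U k S x ≠ 0) :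
    (Finset.univ.filter (fun i => x i = true)).card = S := by
  unfold U at h
  split_ifs at h with hx
  · simpa [slice] using hx
  · exact absurd rfl h

lemma U_perm (k S : ℕ) (σ : Equiv.Perm (Fin k)) (x : Fin k → Bool) :
    U k S (x ∘ σ) = U k S x := by
  have : (Finset.univ.filter (fun i => (x ∘ σ) i = true)).card
      = (Finset.univ.filter (fun i => x i = true)).card :=
    Finset.card_equiv σ (by simp)
  simp only [U, slice, Finset.mem_filter, this, Finset.mem_univ]

lemma sum_perm (k S : ℕ) (σ : Equiv.Perm (Fin k)) (f : (Fin k → Bool) → ℝ) :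
    ∑ x, U k S x * f (x ∘ σ) = ∑ x, U k S x * f x := by
  refine Fintype.sum_equiv (Equiv.arrowCongr σ.symm (Equiv.refl Bool)) _ _ ?_
  intro x
  have : (Equiv.arrowCongr σ.symm (Equiv.refl Bool)) x = x ∘ σ := by
    ext i; simp [Equiv.arrowCongr]
  rw [this, U_perm]

lemma sum_chi {k : ℕ} (x : Fin k → Bool) :
    ∑ i, chi (x i) = 2 * ((Finset.univ.filter (fun i => x i = true)).card : ℝ) - k := by
  have : ∀ i, chi (x i) = 2 * (if x i = true then 1 else 0) - 1 := by
    intro i; unfold chi; split_ifs <;> norm_num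
  simp only [this, Finset.sum_sub_distrib, ← Finset.mul_sum, Finset.sum_boole]
  simp

lemma U_chi_sum {k S : ℕ} (h : S ≤ k) (f : ℝ → ℝ) :
    ∑ x, U k S x * f (∑ i, chi (x i)) = f (2 * S - k) := by
  have : ∀ x, U k S x * f (∑ i, chi (x i)) = U k S x * f (2 * S - k) := by
    intro x
    by_cases hx : U k S x = 0
    · simp [hx]
    · rw [sum_chi, U_supp hx]
  simp only [this, ← Finset.sum_mul, U_sum h, one_mul]

lemma U_one {k S : ℕ} (h : S ≤ k) (i : Fin k) :
    ∑ x, U k S x * chi (x i) = (2 * S - k) / k := by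
  have hk : (k : ℝ) ≠ 0 := by
    have := i.pos
    positivity
  have key : ∀ j, ∑ x, U k S x * chi (x j) = ∑ x, U k S x * chi (x i) := by
    intro j
    have := sum_perm k S (Equiv.swap i j) (fun x => chi (x i))
    simpa using this
  have h1 := U_chi_sum h (fun t => t)
  simp only [Finset.mul_sum] at h1
  rw [Finset.sum_comm] at h1
  simp only [key, Finset.sum_const, Finset.card_univ, Fintype.card_fin, nsmul_eq_mul] at h1
  rw [eq_div_iff hk, ← h1]; ring

lemma U_two {k S : ℕ} (h : S ≤ k) (i j : Fin k) (hij : i ≠ j) :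
    ∑ x, U k S x * (chi (x i) * chi (x j)) = ((2 * S - k) ^ 2 - k) / (k * (k - 1)) := by
  have hk2 : 2 ≤ k := by
    have := i.2; have := j.2
    have : (i : ℕ) ≠ j := fun h => hij (Fin.ext h)
    omega
  have hk : (2 : ℝ) ≤ k := by exact_mod_cast hk2
  have hk0 : (k : ℝ) * (k - 1) ≠ 0 := by
    apply mul_ne_zero <;> linarith
  have key : ∀ a b, ∑ x, U k S x * (chi (x a) * chi (x b))
      = if a = b then 1 else ∑ x, U k S x * (chi (x i) * chi (x j)) := by
    intro a b
    split_ifs with hab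
    · subst hab
      simp only [chi_sq, mul_one, U_sum h]
    · obtain ⟨σ, h1, h2⟩ : ∃ σ : Equiv.Perm (Fin k), σ i = a ∧ σ j = b := by
        have ha : (Equiv.swap i a) j ≠ a := by
          intro h'
          apply hij
          apply (Equiv.swap i a).injective
          rw [h', Equiv.swap_apply_left]
        refine ⟨(Equiv.swap i a).trans (Equiv.swap ((Equiv.swap i a) j) b), ?_, ?_⟩
        · simp only [Equiv.trans_apply, Equiv.swap_apply_left]
          exact Equiv.swap_apply_of_ne_of_ne ha.symm hab
        · simp
      have := sum_perm k S σ (fun x => chi (x i) * chi (x j))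
      simpa [h1, h2] using this
  have h1 := U_chi_sum h (fun t => t ^ 2)
  simp only [sq (∑ i, chi _), Finset.sum_mul_sum] at h1
  simp only [Finset.mul_sum] at h1
  rw [Finset.sum_comm] at h1
  have h2 : ∀ a, ∑ x, ∑ b, U k S x * (chi (x a) * chi (x b))
      = 1 + (k - 1) * ∑ x, U k S x * (chi (x i) * chi (x j)) := by
    intro a
    rw [Finset.sum_comm]
    simp only [key a]
    rw [← Finset.add_sum_erase _ _ (Finset.mem_univ a)]
    rw [if_pos rfl, Finset.sum_congr rfl
      (g := fun _ => ∑ x, U k S x * (chi (x i) * chi (x j)))]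
    · rw [Finset.sum_const, Finset.card_erase_of_mem (Finset.mem_univ a)]
      rw [Finset.card_univ, Fintype.card_fin, nsmul_eq_mul, Nat.cast_sub (by omega)]
      simp
    · intro b hb
      rw [if_neg (Finset.ne_of_mem_erase hb).symm]
  simp only [h2, Finset.sum_const, Finset.card_univ, Fintype.card_fin, nsmul_eq_mul] at h1
  rw [eq_div_iff hk0, ← h1]; ring

/-- Product weight. -/
noncomputable def P (k : ℕ) (S : Fin 4 → ℕ) (x : Fin 4 × Fin k → Bool) : ℝ :=
  ∏ j, U k (S j) (fun i => x (j, i))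

lemma P_prod (k : ℕ) (S : Fin 4 → ℕ) (φ : Fin 4 → (Fin k → Bool) → ℝ) :
    ∑ x, P k S x * ∏ j, φ j (fun i => x (j, i)) = ∏ j, ∑ y, U k (S j) y * φ j y := by
  rw [Finset.prod_univ_sum]
  simp only [P, ← Finset.prod_mul_distrib, Fintype.piFinset_univ]
  exact Fintype.sum_equiv (Equiv.curry (Fin 4) (Fin k) Bool) _ _ (fun x => rfl)

lemma P_sum {k : ℕ} {S : Fin 4 → ℕ} (h : ∀ j, S j ≤ k) : ∑ x, P k S x = 1 := by
  have := P_prod k S (fun _ _ => 1)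
  simpa [U_sum (h _)] using this

lemma P_single {k : ℕ} {S : Fin 4 → ℕ} (h : ∀ j, S j ≤ k) (j : Fin 4)
    (f : (Fin k → Bool) → ℝ) :
    ∑ x, P k S x * f (fun i => x (j, i)) = ∑ y, U k (S j) y * f y := by
  have := P_prod k S (fun j' y => if j' = j then f y else 1)
  simp only [Finset.prod_ite_eq', Finset.mem_univ, if_true] at this
  rw [this, Finset.prod_eq_single j]
  · simp
  · intro b _ hb
    simp [hb, U_sum (h _)]
  · simp

lemma P_double {k : ℕ} {S : Fin 4 → ℕ} (h : ∀ j, S j ≤ k) (j l : Fin 4) (hjl : j ≠ l)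
    (f g : (Fin k → Bool) → ℝ) :
    ∑ x, P k S x * (f (fun i => x (j, i)) * g (fun i => x (l, i)))
      = (∑ y, U k (S j) y * f y) * (∑ y, U k (S l) y * g y) := by
  have := P_prod k S (fun j' y => (if j' = j then f y else 1) * (if j' = l then g y else 1))
  simp only [Finset.prod_mul_distrib, Finset.prod_ite_eq', Finset.mem_univ, if_true] at this
  rw [this, Finset.prod_eq_mul j l hjl]
  · simp [hjl, hjl.symm]
  · intro b _ hb
    simp [hb.1, hb.2, U_sum (h _)]
  · simp
  · simp

lemma ind_eq (a b u v : Bool) : (if u = a ∧ v = b then (1 : ℝ) else 0)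
    = (1 + chi a * chi u + chi b * chi v + chi a * chi b * (chi u * chi v)) / 4 := by
  cases a <;> cases b <;> cases u <;> cases v <;> norm_num [chi]

lemma pairwise_of_moments {ι : Type*} [Fintype ι] [DecidableEq ι] (p : (ι → Bool) → ℝ)
    (h0 : ∑ x, p x = 1) (h1 : ∀ i, ∑ x, p x * chi (x i) = 0)
    (h2 : ∀ i j, i ≠ j → ∑ x, p x * (chi (x i) * chi (x j)) = 0) : PairwiseUniform p := by
  intro i j hij a b
  have e : ∀ x : ι → Bool, (if x i = a ∧ x j = b then p x else 0)
      = (p x + chi a * (p x * chi (x i)) + chi b * (p x * chi (x j))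
        + chi a * chi b * (p x * (chi (x i) * chi (x j)))) / 4 := by
    intro x
    have := ind_eq a b (x i) (x j)
    calc _ = p x * (if x i = a ∧ x j = b then (1 : ℝ) else 0) := by split_ifs <;> simp
      _ = _ := by rw [this]; ring
  rw [Finset.sum_filter]
  simp only [e, ← Finset.sum_div, Finset.sum_add_distrib, ← Finset.mul_sum, h0, h1, h2 i j hij]
  norm_num

lemma mixture {Ω : Type} [Fintype Ω] (w : Ω → ℝ) (k : ℕ) (S : Ω → Fin 4 → ℕ)
    (hw : ∀ ω, 0 ≤ w ω) (hw1 : ∑ ω, w ω = 1) (hS : ∀ ω j, S ω j ≤ k)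
    (m1 : ∀ j, ∑ ω, w ω * (2 * S ω j - k) = 0)
    (m2 : ∀ j, ∑ ω, w ω * (2 * S ω j - k) ^ 2 = (k : ℝ))
    (m3 : ∀ j l, j ≠ l → ∑ ω, w ω * ((2 * S ω j - k) * (2 * S ω l - k)) = 0) :
    ∃ p : (Fin 4 × Fin k → Bool) → ℝ, IsDist p ∧ PairwiseUniform p ∧
      ∀ x, p x ≠ 0 → ∃ ω, ∀ j,
        (Finset.univ.filter (fun i : Fin k => x (j, i) = true)).card = S ω j := by
  have swap : ∀ f : (Fin 4 × Fin k → Bool) → ℝ,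
      ∑ x, (∑ ω, w ω * P k (S ω) x) * f x = ∑ ω, w ω * ∑ x, P k (S ω) x * f x := by
    intro f
    simp only [Finset.sum_mul, Finset.mul_sum]
    rw [Finset.sum_comm]
    simp only [mul_assoc]
  have tot : ∑ x, (∑ ω, w ω * P k (S ω) x) = 1 := by
    have := swap (fun _ => 1)
    simpa [P_sum (hS _), hw1] using this
  refine ⟨fun x => ∑ ω, w ω * P k (S ω) x, ⟨?_, tot⟩, ?_, ?_⟩
  · intro x
    exact Finset.sum_nonneg fun ω _ => mul_nonneg (hw ω)
      (Finset.prod_nonneg fun j _ => U_nonneg _ _ _)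
  · apply pairwise_of_moments _ tot
    · rintro ⟨j, i⟩
      rw [swap]
      have : ∀ ω, ∑ x, P k (S ω) x * chi (x (j, i)) = (2 * S ω j - k) / k := by
        intro ω
        rw [P_single (hS ω) j (fun y => chi (y i)), U_one (hS ω j)]
      simp only [this, ← mul_div_assoc, ← Finset.sum_div, m1, zero_div]
    · rintro ⟨j, i⟩ ⟨l, i'⟩ hne
      rw [swap]
      by_cases hjl : j = l
      · subst hjl
        have hii : i ≠ i' := fun h => hne (by rw [h])
        have : ∀ ω, ∑ x, P k (S ω) x * (chi (x (j, i)) * chi (x (j, i')))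
            = ((2 * S ω j - k) ^ 2 - k) / (k * (k - 1)) := by
          intro ω
          rw [P_single (hS ω) j (fun y => chi (y i) * chi (y i')), U_two (hS ω j) _ _ hii]
        simp only [this, ← mul_div_assoc, ← Finset.sum_div, mul_sub, Finset.sum_sub_distrib,
          ← Finset.sum_mul, hw1]
        have := m2 j
        rw [this]; simp
      · have : ∀ ω, ∑ x, P k (S ω) x * (chi (x (j, i)) * chi (x (l, i')))
            = ((2 * S ω j - k) * (2 * S ω l - k)) / (k * k) := by
          intro ω
          rw [P_double (hS ω) j l hjl (fun y => chi (y i)) (fun y => chi (y i')),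
            U_one (hS ω j), U_one (hS ω l), div_mul_div_comm]
        simp only [this, ← mul_div_assoc, ← Finset.sum_div, m3 j l hjl, zero_div]
  · intro x hx
    obtain ⟨ω, _, hω⟩ := Finset.exists_ne_zero_of_sum_ne_zero hx
    refine ⟨ω, fun j => ?_⟩
    have h1 : P k (S ω) x ≠ 0 := right_ne_zero_of_mul hω
    exact U_supp (Finset.prod_ne_zero_iff.mp h1 j (Finset.mem_univ j))

/-- Base configuration: one low coordinate, or all slightly low. -/
def base (b : Fin 5) (j : Fin 4) : ℤ :=
  if b = 4 then -1 else if (b : ℕ) = j then -2 else 2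

/-- The weight of the base configuration. -/
noncomputable def wb (b : Fin 5) : ℝ := if b = 4 then 1 / 4 else 3 / 16

/-- Noise, affecting only the coordinate `c`. -/
def noise (c : Fin 4) (n : Fin 3) (j : Fin 4) : ℤ := if j = c then (n : ℤ) - 1 else 0

/-- The weight of the noise. -/
noncomputable def wn (q : ℝ) (n : Fin 3) : ℝ := if n = 1 then 1 - 2 * q else q

/-- Half-integer-shifted level. -/
def lev (ω : Fin 5 × Fin 4 × Fin 3) (j : Fin 4) : ℤ := base ω.1 j + noise ω.2.1 ω.2.2 j

/-- Total weight. -/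
noncomputable def wt (q : ℝ) (ω : Fin 5 × Fin 4 × Fin 3) : ℝ :=
  wb ω.1 * (1 / 4) * wn q ω.2.2

lemma lev_bd : ∀ ω j, -3 ≤ lev ω j ∧ lev ω j ≤ 3 := by decide

lemma lev_low : ∀ ω, ∃ j, lev ω j ≤ 0 := by decide

lemma wt_nonneg {q : ℝ} (h0 : 0 ≤ q) (h1 : q ≤ 1 / 2) (ω) : 0 ≤ wt q ω := by
  unfold wt wb wn
  split_ifs <;> first | positivity | (apply mul_nonneg <;> linarith)

/-- Weight of the noise component. -/
noncomputable def wv (q : ℝ) (y : Fin 4 × Fin 3) : ℝ := (1 / 4) * wn q y.2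

lemma wt_eq (q : ℝ) (ω : Fin 5 × Fin 4 × Fin 3) : wt q ω = wb ω.1 * wv q ω.2 := by
  unfold wt wv; ring

lemma wb_sum : ∑ b, wb b = 1 := by
  simp only [Fin.sum_univ_five, wb]
  norm_num [Fin.ext_iff]

lemma wv_sum (q : ℝ) : ∑ y, wv q y = 1 := by
  simp only [Fintype.sum_prod_type, Fin.sum_univ_four, Fin.sum_univ_three, wv, wn]
  norm_num [Fin.ext_iff]
  ring

/-- Real base value. -/
def rb (j : Fin 4) (b : Fin 5) : ℝ := 2 * (base b j : ℝ) - 1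

/-- Real noise value. -/
def rn (j : Fin 4) (y : Fin 4 × Fin 3) : ℝ := 2 * (noise y.1 y.2 j : ℝ)

lemma lev_eq (ω : Fin 5 × Fin 4 × Fin 3) (j : Fin 4) :
    2 * (lev ω j : ℝ) - 1 = rb j ω.1 + rn j ω.2 := by
  unfold lev rb rn; push_cast; ring

lemma rb_eq (j : Fin 4) (b : Fin 5) :
    rb j b = if b = 4 then -3 else if (b : ℕ) = j then -5 else 3 := by
  unfold rb base; split_ifs <;> norm_num

lemma rn_sum (q : ℝ) (j : Fin 4) (c : Fin 4) : ∑ n, wv q (c, n) * rn j (c, n) = 0 := by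
  simp only [Fin.sum_univ_three, wv, wn, rn, noise]
  by_cases h : j = c
  · norm_num [h, Fin.ext_iff]
    try ring
  · simp [h]

lemma rn_sum' (q : ℝ) (j : Fin 4) : ∑ y, wv q y * rn j y = 0 := by
  simp [Fintype.sum_prod_type, rn_sum]

lemma rn_sq_aux (q : ℝ) (j : Fin 4) (c : Fin 4) :
    ∑ n, wv q (c, n) * (rn j (c, n) * rn j (c, n)) = if j = c then 2 * q else 0 := by
  simp only [Fin.sum_univ_three, wv, wn, rn, noise]
  by_cases h : j = c
  · norm_num [h, Fin.ext_iff]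
    try ring
  · simp [h]

lemma rn_sq (q : ℝ) (j : Fin 4) : ∑ y, wv q y * (rn j y * rn j y) = 2 * q := by
  simp [Fintype.sum_prod_type, rn_sq_aux]

lemma rn_cross (q : ℝ) (j l : Fin 4) (h : j ≠ l) :
    ∑ y, wv q y * (rn j y * rn l y) = 0 := by
  apply Finset.sum_eq_zero
  intro y _
  unfold rn noise
  by_cases h1 : j = y.1
  · have : l ≠ y.1 := fun h2 => h (h1.trans h2.symm)
    simp [this]
  · simp [h1]

lemma rb_sum (j : Fin 4) : ∑ b, wb b * rb j b = 0 := by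
  simp only [Fin.sum_univ_five, wb, rb_eq]
  fin_cases j <;> norm_num [Fin.ext_iff]

lemma rb_sq (j : Fin 4) : ∑ b, wb b * (rb j b * rb j b) = 12 := by
  simp only [Fin.sum_univ_five, wb, rb_eq]
  fin_cases j <;> norm_num [Fin.ext_iff]

lemma rb_cross (j l : Fin 4) (h : j ≠ l) : ∑ b, wb b * (rb j b * rb l b) = 0 := by
  simp only [Fin.sum_univ_five, wb, rb_eq]
  fin_cases j <;> fin_cases l <;> first | exact absurd rfl h | norm_num [Fin.ext_iff]

lemma wt_prod (q : ℝ) (f : Fin 5 → ℝ) (g : Fin 4 × Fin 3 → ℝ) :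
    ∑ ω, wt q ω * (f ω.1 * g ω.2) = (∑ b, wb b * f b) * ∑ y, wv q y * g y := by
  rw [Fintype.sum_prod_type, Finset.sum_mul_sum]
  refine Finset.sum_congr rfl fun b _ => Finset.sum_congr rfl fun y _ => ?_
  rw [wt_eq]; ring

lemma wt_sum (q : ℝ) : ∑ ω, wt q ω = 1 := by
  simpa [wb_sum, wv_sum] using wt_prod q (fun _ => 1) (fun _ => 1)

lemma wt_m1 (q : ℝ) (j : Fin 4) : ∑ ω, wt q ω * (2 * (lev ω j : ℝ) - 1) = 0 := by
  have h1 := wt_prod q (rb j) (fun _ => 1)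
  have h2 := wt_prod q (fun _ => 1) (rn j)
  rw [rb_sum, zero_mul] at h1
  rw [rn_sum', mul_zero] at h2
  rw [← add_zero (0 : ℝ)]
  nth_rewrite 1 [← h1]
  rw [← h2, ← Finset.sum_add_distrib]
  refine Finset.sum_congr rfl fun ω _ => ?_
  rw [lev_eq]; ring

lemma wt_cov (q : ℝ) (j l : Fin 4) :
    ∑ ω, wt q ω * ((2 * (lev ω j : ℝ) - 1) * (2 * (lev ω l : ℝ) - 1))
      = (∑ b, wb b * (rb j b * rb l b)) + ∑ y, wv q y * (rn j y * rn l y) := by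
  have h1 := wt_prod q (fun b => rb j b * rb l b) (fun _ => 1)
  have h2 := wt_prod q (fun _ => 1) (fun y => rn j y * rn l y)
  have h3 := wt_prod q (rb j) (rn l)
  have h4 := wt_prod q (rb l) (rn j)
  simp only [mul_one, wb_sum, wv_sum, one_mul] at h1 h2
  rw [rb_sum, zero_mul] at h3 h4
  have : ∀ ω, wt q ω * ((2 * (lev ω j : ℝ) - 1) * (2 * (lev ω l : ℝ) - 1))
      = wt q ω * (rb j ω.1 * rb l ω.1) + wt q ω * (rn j ω.2 * rn l ω.2)
        + wt q ω * (rb j ω.1 * rn l ω.2) + wt q ω * (rb l ω.1 * rn j ω.2) := by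
    intro ω
    rw [lev_eq, lev_eq]; ring
  simp only [this, Finset.sum_add_distrib]
  rw [h1, h2, h3, h4]; ring

lemma wt_m2 (q : ℝ) (j : Fin 4) :
    ∑ ω, wt q ω * (2 * (lev ω j : ℝ) - 1) ^ 2 = 12 + 2 * q := by
  simp only [sq]
  rw [wt_cov, rb_sq, rn_sq]

lemma wt_m3 (q : ℝ) (j l : Fin 4) (h : j ≠ l) :
    ∑ ω, wt q ω * ((2 * (lev ω j : ℝ) - 1) * (2 * (lev ω l : ℝ) - 1)) = 0 := by
  rw [wt_cov, rb_cross j l h, rn_cross q j l h, add_zero]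

lemma exists_scale (k : ℕ) (hk : 43200 ≤ k) :
    ∃ s m : ℕ, k = s + 2 * m ∧ 49 ≤ s ∧ 12 * s ^ 2 ≤ k ∧ k ≤ 13 * s ^ 2 := by
  obtain ⟨r, hr1, hr2⟩ : ∃ r : ℕ, r * r ≤ k / 12 ∧ k / 12 < (r + 1) * (r + 1) :=
    ⟨Nat.sqrt (k / 12), Nat.sqrt_le _, Nat.lt_succ_sqrt _⟩
  have a1 : 12 * (r * r) ≤ k := by omega
  have a2 : k < 12 * ((r + 1) * (r + 1)) := by omega
  have a3 : 59 ≤ r := by nlinarith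
  obtain ⟨s, hs1, hs2, hs3⟩ : ∃ s : ℕ, s ≤ r ∧ r ≤ s + 1 ∧ s % 2 = k % 2 := by
    by_cases h : r % 2 = k % 2
    · exact ⟨r, le_rfl, by omega, h⟩
    · exact ⟨r - 1, by omega, by omega, by omega⟩
  have hs : 58 ≤ s := by omega
  have b1 : 12 * s ^ 2 ≤ k := by nlinarith
  refine ⟨s, (k - s) / 2, ?_, by omega, b1, ?_⟩
  · have : s ≤ k := by nlinarith
    omega
  · nlinarith

end Aux

open Aux

/-- There exists `k₀` such that for every `k ≥ k₀` there is a
pairwise uniform probability distribution on `({0,1}^k)^4` (pairwise uniform with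
respect to all `4k` coordinates, indexed by `Fin 4 × Fin k`) supported inside the set
of tuples `(x¹,x²,x³,x⁴)` such that some block `x^j` has fewer than `⌈k/2⌉ - 1`
coordinates equal to `1`. -/
theorem stmt11 : ∃ k0 : ℕ, ∀ k : ℕ, k0 ≤ k →
    ∃ p : (Fin 4 × Fin k → Bool) → ℝ, IsDist p ∧ PairwiseUniform p ∧
      ∀ x : Fin 4 × Fin k → Bool, p x ≠ 0 → ∃ j : Fin 4,
        (Finset.univ.filter (fun i : Fin k => x (j, i) = true)).card
          < (k + 1) / 2 - 1 := by
  refine ⟨43200, fun k hk => ?_⟩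
  obtain ⟨s, m, hksm, hs, hl, hu⟩ := exists_scale k hk
  have hm : 3 * s ≤ m := by nlinarith
  have hs0 : (0 : ℝ) < s := by
    have : 0 < s := by omega
    exact_mod_cast this
  have hl' : (12 : ℝ) * s ^ 2 ≤ k := by exact_mod_cast hl
  have hu' : (k : ℝ) ≤ 13 * s ^ 2 := by exact_mod_cast hu
  set q : ℝ := (k - 12 * s ^ 2) / (2 * s ^ 2) with hq
  have hq0 : 0 ≤ q := div_nonneg (by linarith) (by positivity)
  have hq1 : q ≤ 1 / 2 := by
    rw [hq, div_le_iff₀ (by positivity)]; linarith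
  have hqk : (s : ℝ) ^ 2 * (12 + 2 * q) = k := by
    rw [hq]; field_simp; ring
  have lo : ∀ ω j, 0 ≤ (m : ℤ) + s * lev ω j := by
    intro ω j
    have := (lev_bd ω j).1
    have h3 : (3 : ℤ) * s ≤ m := by exact_mod_cast hm
    nlinarith
  have hi : ∀ ω j, (m : ℤ) + s * lev ω j ≤ k := by
    intro ω j
    have := (lev_bd ω j).2
    have h3 : (3 : ℤ) * s ≤ m := by exact_mod_cast hm
    have h4 : (k : ℤ) = s + 2 * m := by exact_mod_cast hksm
    nlinarith
  let S : Fin 5 × Fin 4 × Fin 3 → Fin 4 → ℕ := fun ω j => ((m : ℤ) + s * lev ω j).toNat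
  have hSc : ∀ ω j, (S ω j : ℤ) = (m : ℤ) + s * lev ω j := fun ω j => Int.toNat_of_nonneg (lo ω j)
  have hd : ∀ ω j, (2 * (S ω j : ℝ) - k) = s * (2 * (lev ω j : ℝ) - 1) := by
    intro ω j
    have h1 : (S ω j : ℝ) = (m : ℝ) + s * lev ω j := by exact_mod_cast hSc ω j
    have h2 : (k : ℝ) = s + 2 * m := by exact_mod_cast hksm
    rw [h1, h2]; ring
  obtain ⟨p, hp1, hp2, hp3⟩ := mixture (wt q) k S (wt_nonneg hq0 hq1) (wt_sum q)
    (fun ω j => by have := hSc ω j; have := hi ω j; omega)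
    (fun j => by
      simp only [hd]
      rw [← mul_zero (s : ℝ), ← wt_m1 q j, Finset.mul_sum]
      exact Finset.sum_congr rfl fun ω _ => by ring)
    (fun j => by
      simp only [hd]
      rw [← hqk, ← wt_m2 q j, Finset.mul_sum]
      exact Finset.sum_congr rfl fun ω _ => by ring)
    (fun j l hjl => by
      simp only [hd]
      rw [← mul_zero ((s : ℝ) ^ 2), ← wt_m3 q j l hjl, Finset.mul_sum]
      exact Finset.sum_congr rfl fun ω _ => by ring)
  refine ⟨p, hp1, hp2, fun x hx => ?_⟩
  obtain ⟨ω, hω⟩ := hp3 x hx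
  obtain ⟨j, hj⟩ := lev_low ω
  refine ⟨j, ?_⟩
  rw [hω j]
  have h1 := hSc ω j
  have h2 : (s : ℤ) * lev ω j ≤ 0 := mul_nonpos_of_nonneg_of_nonpos (by positivity) hj
  omega
end

section
/- Fix integers k > r > d ≥ 1 with r > max{17d, 544}. For each n, let A_1, ..., A_{n^d} be chosen independently and uniformly at random from the k-element subsets of [n]. Let E_n be the event that for every subset I ⊆ [n^d] with |I| ≤ n^{3/4}, more than half of the indices i ∈ I satisfy |A_i \ ⋃_{j ∈ I, j ≠ i} A_j| ≥ k − r. Then Pr(E_n) → 1 as n → ∞. -/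
open Filter

lemma desc_ratio (n t : ℕ) (h : t ≤ n) (k : ℕ) :
    t.descFactorial k * n ^ k ≤ n.descFactorial k * t ^ k := by
  induction k with
  | zero => simp
  | succ k ih =>
    rw [Nat.descFactorial_succ, Nat.descFactorial_succ, pow_succ, pow_succ]
    have h1 : (t - k) * n ≤ (n - k) * t := by
      rw [Nat.sub_mul, Nat.sub_mul, mul_comm n t]
      have : k * t ≤ k * n := Nat.mul_le_mul_left _ h
      omega
    calc (t - k) * t.descFactorial k * (n ^ k * n)
        = ((t - k) * n) * (t.descFactorial k * n ^ k) := by ring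
      _ ≤ ((n - k) * t) * (n.descFactorial k * t ^ k) := Nat.mul_le_mul h1 ih
      _ = _ := by ring

lemma choose_ratio (n t : ℕ) (h : t ≤ n) (k : ℕ) :
    t.choose k * n ^ k ≤ n.choose k * t ^ k := by
  have := desc_ratio n t h k
  rw [Nat.descFactorial_eq_factorial_mul_choose, Nat.descFactorial_eq_factorial_mul_choose,
    mul_assoc, mul_assoc] at this
  exact Nat.le_of_mul_le_mul_left this (Nat.factorial_pos k)

lemma union_small {ι α : Type*} [DecidableEq ι] [DecidableEq α] (k r : ℕ) (hkr : r < k)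
    (I : Finset ι) (A : ι → Finset α) (hA : ∀ i, (A i).card = k)
    (hbad : 2 * (I.filter (fun i =>
              k - r ≤ ((A i) \ (I.erase i).biUnion A).card)).card ≤ I.card) :
    4 * (I.biUnion A).card + I.card * (r + 1) ≤ 4 * (I.card * k) := by
  classical
  set P : ι → Finset α := fun i => (A i) \ (I.erase i).biUnion A with hP
  have h1 : 2 * (I.biUnion A).card ≤ I.card * k + ∑ i ∈ I, (P i).card := by
    have e1 : I.card * k = ∑ i ∈ I, ∑ x ∈ I.biUnion A, if x ∈ A i then 1 else 0 := by
      rw [← smul_eq_mul, ← Finset.sum_const]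
      refine Finset.sum_congr rfl fun i hi => ?_
      rw [← Finset.card_filter, ← hA i]
      congr 1
      ext x
      simp only [Finset.mem_filter, Finset.mem_biUnion]
      exact ⟨fun h => ⟨⟨i, hi, h⟩, h⟩, fun h => h.2⟩
    have e2 : ∑ i ∈ I, (P i).card = ∑ i ∈ I, ∑ x ∈ I.biUnion A, if x ∈ P i then 1 else 0 := by
      refine Finset.sum_congr rfl fun i hi => ?_
      rw [← Finset.card_filter]
      congr 1
      ext x
      simp only [Finset.mem_filter, Finset.mem_biUnion]
      exact ⟨fun h => ⟨⟨i, hi, (Finset.mem_sdiff.1 h).1⟩, h⟩, fun h => h.2⟩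
    rw [e1, e2, Finset.sum_comm, Finset.sum_comm (s := I) (t := I.biUnion A),
      ← Finset.sum_add_distrib, mul_comm, ← smul_eq_mul, ← Finset.sum_const]
    refine Finset.sum_le_sum fun x hx => ?_
    rw [← Finset.card_filter, ← Finset.card_filter]
    obtain ⟨i, hi, hxi⟩ := Finset.mem_biUnion.1 hx
    by_cases h : x ∈ (I.erase i).biUnion A
    · obtain ⟨j, hj, hxj⟩ := Finset.mem_biUnion.1 h
      rw [Finset.mem_erase] at hj
      have : ({i, j} : Finset ι) ⊆ I.filter (fun i => x ∈ A i) := by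
        intro y hy
        simp only [Finset.mem_insert, Finset.mem_singleton] at hy
        rcases hy with rfl | rfl
        · simp [hi, hxi]
        · simp [hj.2, hxj]
      have h2 := Finset.card_le_card this
      rw [Finset.card_pair (Ne.symm hj.1)] at h2
      omega
    · have a1 : 0 < (I.filter (fun i => x ∈ A i)).card :=
        Finset.card_pos.2 ⟨i, by simp [hi, hxi]⟩
      have a2 : 0 < (I.filter (fun i => x ∈ P i)).card :=
        Finset.card_pos.2 ⟨i, Finset.mem_filter.2 ⟨hi, Finset.mem_sdiff.2 ⟨hxi, h⟩⟩⟩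
      omega
  have h2 : ∑ i ∈ I, (P i).card + (r + 1) * (I.filter (fun i => ¬ k - r ≤ (P i).card)).card
      ≤ I.card * k := by
    rw [Finset.card_filter, Finset.mul_sum, ← Finset.sum_add_distrib, ← smul_eq_mul (I.card),
      ← Finset.sum_const]
    refine Finset.sum_le_sum fun i hi => ?_
    have : (P i).card ≤ k := by
      rw [← hA i]; exact Finset.card_le_card Finset.sdiff_subset
    split_ifs <;> simp only [mul_one, mul_zero] <;> omega
  have h3 := Finset.card_filter_add_card_filter_not (s := I) (fun i => k - r ≤ (P i).card)
  have h4 : I.card ≤ 2 * (I.filter (fun i => ¬ k - r ≤ (P i).card)).card := by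
    change 2 * (I.filter (fun i => k - r ≤ (P i).card)).card ≤ I.card at hbad
    omega
  nlinarith

noncomputable def bta (k r n : ℕ) : ℝ :=
  Real.exp k * ((k : ℝ) * (n : ℝ) ^ (-(1 / 4) : ℝ)) ^ (((r : ℝ) + 1) / 4)

lemma main_ineq (k r n m t : ℕ) (hk : 0 < k) (hn : 0 < n) (htn : t ≤ n)
    (hkn : (k : ℝ) * (n : ℝ) ^ (-(1 / 4) : ℝ) ≤ 1)
    (hm : (m : ℝ) ≤ (n : ℝ) ^ ((3 : ℝ) / 4)) (ht : 4 * t + m * (r + 1) ≤ 4 * (m * k)) :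
    (n.choose t : ℝ) * (t.choose k : ℝ) ^ m ≤ bta k r n ^ m * (n.choose k : ℝ) ^ m := by
  have hn' : (0 : ℝ) < n := by exact_mod_cast hn
  have htm : t ≤ m * k := by omega
  obtain ⟨s, hs⟩ := Nat.exists_eq_add_of_le htm
  set b : ℝ := (k : ℝ) * (n : ℝ) ^ (-(1 / 4) : ℝ) with hb
  have hb0 : 0 < b := by positivity
  have h1 : (t.choose k : ℝ) ≤ n.choose k * ((t : ℝ) / n) ^ k := by
    rw [div_pow, ← mul_div_assoc, le_div_iff₀ (by positivity)]
    exact_mod_cast choose_ratio n t htn k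
  have h2 : (n.choose t : ℝ) ≤ (n : ℝ) ^ t / t.factorial := Nat.choose_le_pow_div t n
  have h3 : (t : ℝ) ^ t / t.factorial ≤ Real.exp t :=
    Real.pow_div_factorial_le_exp _ (by positivity) t
  have h4 : (t : ℝ) / n ≤ b := by
    rw [div_le_iff₀ hn']
    calc (t : ℝ) ≤ m * k := by exact_mod_cast htm
      _ ≤ (n : ℝ) ^ ((3 : ℝ) / 4) * k := by gcongr
      _ = k * ((n : ℝ) ^ (-(1 / 4) : ℝ) * (n : ℝ) ^ (1 : ℝ)) := by
          rw [← Real.rpow_add hn']; norm_num; ring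
      _ = b * n := by rw [Real.rpow_one, hb]; ring
  have h5 : b ^ s ≤ (b ^ (((r : ℝ) + 1) / 4)) ^ m := by
    rw [← Real.rpow_natCast, ← Real.rpow_natCast, ← Real.rpow_mul hb0.le]
    apply Real.rpow_le_rpow_of_exponent_ge hb0 hkn
    have : m * (r + 1) ≤ 4 * s := by omega
    have : (m : ℝ) * (r + 1) ≤ 4 * s := by exact_mod_cast this
    linarith
  have h6 : Real.exp t ≤ Real.exp k ^ m := by
    rw [← Real.exp_nat_mul]
    apply Real.exp_le_exp.2
    exact_mod_cast htm
  calc (n.choose t : ℝ) * (t.choose k : ℝ) ^ m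
      ≤ ((n : ℝ) ^ t / t.factorial) * (n.choose k * ((t : ℝ) / n) ^ k) ^ m := by gcongr
    _ = ((t : ℝ) ^ t / t.factorial) * ((t : ℝ) / n) ^ s * (n.choose k : ℝ) ^ m := by
        rw [mul_pow, ← pow_mul, mul_comm k m, hs, pow_add, div_pow (t : ℝ) n t]
        field_simp
    _ ≤ Real.exp k ^ m * (b ^ (((r : ℝ) + 1) / 4)) ^ m * (n.choose k : ℝ) ^ m := by
        have : ((t : ℝ) / n) ^ s ≤ (b ^ (((r : ℝ) + 1) / 4)) ^ m :=
          (pow_le_pow_left₀ (by positivity) h4 s).trans h5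
        gcongr
        exact h3.trans h6
    _ = _ := by rw [bta, mul_pow]

lemma bta_tendsto (k r d : ℕ) (hr : 16 * d < r) :
    Tendsto (fun n : ℕ => bta k r n * ((n ^ d : ℕ) : ℝ)) atTop (nhds 0) := by
  have h : Tendsto (fun n : ℕ => (Real.exp k * (k : ℝ) ^ (((r : ℝ) + 1) / 4)) *
      (n : ℝ) ^ (-(((r : ℝ) + 1) / 16 - d))) atTop (nhds 0) := by
    rw [← mul_zero (Real.exp k * (k : ℝ) ^ (((r : ℝ) + 1) / 4))]
    refine Tendsto.const_mul _ ?_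
    refine (tendsto_rpow_neg_atTop ?_).comp tendsto_natCast_atTop_atTop
    have : (16 : ℝ) * d < r := by exact_mod_cast hr
    linarith
  refine h.congr' ?_
  filter_upwards [eventually_gt_atTop 0] with n hn
  have hn' : (0 : ℝ) < n := by exact_mod_cast hn
  rw [bta, Real.mul_rpow (by positivity) (by positivity), ← Real.rpow_mul hn'.le]
  push_cast
  rw [← Real.rpow_natCast (n : ℝ) d, mul_assoc, mul_assoc, mul_assoc, ← Real.rpow_add hn']
  congr 3
  ring

lemma count_one {N n k t : ℕ} (I : Finset (Fin N)) (T : Finset (Fin n)) (hT : T.card = t) :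
    (Finset.univ.filter (fun A : Fin N → {B : Finset (Fin n) // B.card = k} =>
      ∀ i ∈ I, (A i).1 ⊆ T)).card = (t.choose k) ^ I.card * (n.choose k) ^ (N - I.card) := by
  classical
  have hc1 : (Finset.univ.filter (fun B : {B : Finset (Fin n) // B.card = k} => B.1 ⊆ T)).card
      = t.choose k := by
    rw [← hT, ← Finset.card_powersetCard, ← Finset.card_map (Function.Embedding.subtype _)]
    congr 1
    ext B
    simp [Finset.mem_powersetCard, and_comm]
  have hc2 : Fintype.card {B : Finset (Fin n) // B.card = k} = n.choose k := by
    rw [Fintype.card_finset_len, Fintype.card_fin]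
  have : (Finset.univ.filter (fun A : Fin N → {B : Finset (Fin n) // B.card = k} =>
      ∀ i ∈ I, (A i).1 ⊆ T)) = Fintype.piFinset (fun i => if i ∈ I then
        (Finset.univ.filter (fun B : {B : Finset (Fin n) // B.card = k} => B.1 ⊆ T)) else
        Finset.univ) := by
    ext A
    simp only [Finset.mem_filter, Finset.mem_univ, true_and, Fintype.mem_piFinset]
    refine forall_congr' fun i => ?_
    split_ifs with h <;> simp [h]
  rw [this, Fintype.card_piFinset, ← Finset.prod_mul_prod_compl I]
  congr 1
  · rw [← Finset.prod_const]
    refine Finset.prod_congr rfl fun i hi => ?_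
    rw [if_pos hi, hc1]
  · have : N - I.card = Iᶜ.card := by rw [Finset.card_compl, Fintype.card_fin]
    rw [this, ← Finset.prod_const]
    refine Finset.prod_congr rfl fun i hi => ?_
    rw [if_neg (Finset.mem_compl.1 hi), Finset.card_univ, hc2]

lemma bad_bound (k r n N : ℕ) (hkr : r < k) (hn : 0 < n)
    (hkn : (k : ℝ) * (n : ℝ) ^ (-(1 / 4) : ℝ) ≤ 1) :
    (Nat.card {A : Fin N → {B : Finset (Fin n) // B.card = k} //
          ¬ ∀ I : Finset (Fin N), I.Nonempty →
            (I.card : ℝ) ≤ (n : ℝ) ^ ((3 : ℝ) / 4) →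
            I.card < 2 * (I.filter (fun i =>
              k - r ≤ ((A i).1 \ (I.erase i).biUnion (fun j => (A j).1)).card)).card} : ℝ)
      ≤ (Real.exp (bta k r n * N) - 1) * (n.choose k : ℝ) ^ N := by
  classical
  have hn' : (0 : ℝ) < n := by exact_mod_cast hn
  have hb0 : 0 ≤ bta k r n := by unfold bta; positivity
  let t : ℕ → ℕ := fun m => (4 * (m * k) - m * (r + 1)) / 4
  let S : Finset (Finset (Fin N)) := Finset.univ.filter (fun I => I.Nonempty ∧
    (I.card : ℝ) ≤ (n : ℝ) ^ ((3 : ℝ) / 4))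
  have ht : ∀ m, 4 * t m + m * (r + 1) ≤ 4 * (m * k) := by
    intro m
    have : m * (r + 1) ≤ m * k := Nat.mul_le_mul_left _ hkr
    simp only [t]; omega
  have htn : ∀ m : ℕ, (m : ℝ) ≤ (n : ℝ) ^ ((3 : ℝ) / 4) → t m ≤ n := by
    intro m hm
    have h1 : t m ≤ m * k := by have := ht m; omega
    have h2 : (m : ℝ) * k ≤ n := by
      calc (m : ℝ) * k ≤ (n : ℝ) ^ ((3 : ℝ) / 4) * k := by gcongr
        _ = (k * (n : ℝ) ^ (-(1 / 4) : ℝ)) * (n : ℝ) ^ (1 : ℝ) := by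
          rw [mul_assoc, ← Real.rpow_add hn']; norm_num; ring
        _ ≤ 1 * (n : ℝ) ^ (1 : ℝ) := by gcongr
        _ = n := by simp
    have h3 : m * k ≤ n := by exact_mod_cast h2
    omega
  rw [Nat.card_eq_fintype_card, Fintype.card_subtype]
  have hsub : (Finset.univ.filter (fun A : Fin N → {B : Finset (Fin n) // B.card = k} =>
          ¬ ∀ I : Finset (Fin N), I.Nonempty →
            (I.card : ℝ) ≤ (n : ℝ) ^ ((3 : ℝ) / 4) →
            I.card < 2 * (I.filter (fun i =>
              k - r ≤ ((A i).1 \ (I.erase i).biUnion (fun j => (A j).1)).card)).card)) ⊆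
      S.biUnion (fun I => (Finset.powersetCard (t I.card) Finset.univ).biUnion (fun T =>
        Finset.univ.filter (fun A : Fin N → {B : Finset (Fin n) // B.card = k} =>
      ∀ i ∈ I, (A i).1 ⊆ T))) := by
    intro A hA
    rw [Finset.mem_filter] at hA
    have hA2 := hA.2
    push Not at hA2
    obtain ⟨I, hI, hIn, hbad⟩ := hA2
    have hu := union_small k r hkr I (fun j => (A j).1) (fun i => (A i).2) hbad
    have hu2 : (I.biUnion (fun j => (A j).1)).card ≤ t I.card := by
      simp only [t]; omega
    obtain ⟨T, hT, hTc⟩ := Finset.exists_superset_card_eq hu2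
      (by rw [Fintype.card_fin]; exact htn _ hIn)
    simp only [Finset.mem_biUnion]
    refine ⟨I, by simp [S, hI, hIn], T, by simp [Finset.mem_powersetCard, hTc], ?_⟩
    simp only [Finset.mem_filter, Finset.mem_univ, true_and]
    intro i hi
    exact (Finset.subset_biUnion_of_mem (fun j => (A j).1) hi).trans hT
  have hc := (Finset.card_le_card hsub).trans Finset.card_biUnion_le
  have hstep : ∀ I ∈ S, ((((Finset.powersetCard (t I.card) Finset.univ).biUnion (fun T =>
        Finset.univ.filter (fun A : Fin N → {B : Finset (Fin n) // B.card = k} =>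
      ∀ i ∈ I, (A i).1 ⊆ T))).card : ℕ) : ℝ) ≤ bta k r n ^ I.card * (n.choose k : ℝ) ^ N := by
    intro I hI
    have hI2 := (Finset.mem_filter.1 hI).2
    have hIN : I.card ≤ N := by simpa using Finset.card_le_univ I
    have hle : ((Finset.powersetCard (t I.card) Finset.univ).biUnion (fun T =>
        Finset.univ.filter (fun A : Fin N → {B : Finset (Fin n) // B.card = k} =>
      ∀ i ∈ I, (A i).1 ⊆ T))).card ≤
        n.choose (t I.card) * (((t I.card).choose k) ^ I.card * (n.choose k) ^ (N - I.card)) := by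
      refine Finset.card_biUnion_le.trans ?_
      rw [Finset.sum_congr rfl fun T hT => count_one I T (Finset.mem_powersetCard.1 hT).2]
      rw [Finset.sum_const, Finset.card_powersetCard, Finset.card_univ, Fintype.card_fin,
        smul_eq_mul]
    have hm := main_ineq k r n I.card (t I.card) (by omega) hn (htn _ hI2.2) hkn hI2.2 (ht _)
    calc _ ≤ ((n.choose (t I.card) * (((t I.card).choose k) ^ I.card *
            (n.choose k) ^ (N - I.card)) : ℕ) : ℝ) := by exact_mod_cast hle
      _ = ((n.choose (t I.card) : ℝ) * ((t I.card).choose k : ℝ) ^ I.card) *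
            (n.choose k : ℝ) ^ (N - I.card) := by push_cast; ring
      _ ≤ (bta k r n ^ I.card * (n.choose k : ℝ) ^ I.card) *
            (n.choose k : ℝ) ^ (N - I.card) := by gcongr
      _ = _ := by rw [mul_assoc, ← pow_add, Nat.add_sub_cancel' hIN]
  have hsum : ∑ I ∈ S, bta k r n ^ I.card ≤ Real.exp (bta k r n * N) - 1 := by
    have h1 : ∑ I ∈ S, bta k r n ^ I.card ≤
        ∑ I ∈ (Finset.univ : Finset (Finset (Fin N))).erase ∅, bta k r n ^ I.card := by
      refine Finset.sum_le_sum_of_subset_of_nonneg ?_ fun _ _ _ => by positivity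
      intro I hI
      have hI2 := (Finset.mem_filter.1 hI).2
      simp [hI2.1.ne_empty]
    have h2 := Finset.add_sum_erase (Finset.univ : Finset (Finset (Fin N)))
      (fun I => bta k r n ^ I.card) (Finset.mem_univ ∅)
    have h3 := Fintype.sum_pow_mul_eq_add_pow (Fin N) (bta k r n) 1
    simp only [one_pow, mul_one, Fintype.card_fin] at h3
    simp only [Finset.card_empty, pow_zero] at h2
    have h4 : (bta k r n + 1) ^ N ≤ Real.exp (bta k r n * N) := by
      rw [mul_comm, Real.exp_nat_mul]
      exact pow_le_pow_left₀ (by positivity) (Real.add_one_le_exp _) N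
    linarith
  calc _ ≤ ((∑ I ∈ S, ((Finset.powersetCard (t I.card) Finset.univ).biUnion (fun T =>
        Finset.univ.filter (fun A : Fin N → {B : Finset (Fin n) // B.card = k} =>
      ∀ i ∈ I, (A i).1 ⊆ T))).card : ℕ) : ℝ) := by exact_mod_cast hc
    _ ≤ ∑ I ∈ S, bta k r n ^ I.card * (n.choose k : ℝ) ^ N := by
        push_cast
        exact Finset.sum_le_sum hstep
    _ = (∑ I ∈ S, bta k r n ^ I.card) * (n.choose k : ℝ) ^ N := by rw [Finset.sum_mul]
    _ ≤ _ := by gcongr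


/-- Fix integers `k > r > d ≥ 1` with `r > max(17d, 544)`.  For each
`n`, choose `A 0, …, A (n^d - 1)` independently and uniformly at random among the
`k`-element subsets of `[n]` (formalized by counting: the fraction of tuples of
`k`-subsets with the property below).  Let `E_n` be the event that for every nonempty
`I ⊆ [n^d]` with `|I| ≤ n^(3/4)`, more than half of the indices `i ∈ I` satisfy
`|A i \ ⋃_{j ∈ I, j ≠ i} A j| ≥ k - r` (for `I = ∅` the condition "more than half of
the indices of `I`" holds vacuously).  Then `Pr(E_n) → 1` as `n → ∞`. -/
theorem stmt14 (k r d : ℕ) (hd : 1 ≤ d) (hrd : d < r) (hkr : r < k)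
    (hr : max (17 * d) 544 < r) :
    Tendsto (fun n : ℕ =>
      (Nat.card {A : Fin (n ^ d) → {B : Finset (Fin n) // B.card = k} //
          ∀ I : Finset (Fin (n ^ d)), I.Nonempty →
            (I.card : ℝ) ≤ (n : ℝ) ^ ((3 : ℝ) / 4) →
            I.card < 2 * (I.filter (fun i =>
              k - r ≤ ((A i).1 \ (I.erase i).biUnion (fun j => (A j).1)).card)).card} : ℝ)
        / (Nat.card (Fin (n ^ d) → {B : Finset (Fin n) // B.card = k}) : ℝ))
      atTop (nhds 1) := by
  have hr' : 16 * d < r := by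
    have := (le_max_left (17 * d) 544).trans_lt hr
    omega
  have hlim : Tendsto (fun n : ℕ => 1 - (Real.exp (bta k r n * ((n ^ d : ℕ) : ℝ)) - 1))
      atTop (nhds 1) := by
    have h := (Real.continuous_exp.tendsto 0).comp (bta_tendsto k r d hr')
    rw [Real.exp_zero] at h
    have h2 := (h.sub_const 1).const_sub 1
    simpa using h2
  have hk1 : ∀ᶠ n : ℕ in atTop, (k : ℝ) * (n : ℝ) ^ (-(1 / 4) : ℝ) ≤ 1 := by
    have h : Tendsto (fun n : ℕ => (k : ℝ) * (n : ℝ) ^ (-(1 / 4) : ℝ)) atTop (nhds 0) := by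
      rw [← mul_zero (k : ℝ)]
      exact Tendsto.const_mul _
        ((tendsto_rpow_neg_atTop (by norm_num)).comp tendsto_natCast_atTop_atTop)
    exact (h.eventually (gt_mem_nhds one_pos)).mono fun _ h => le_of_lt h
  refine tendsto_of_tendsto_of_tendsto_of_le_of_le' hlim tendsto_const_nhds ?_ ?_
  · filter_upwards [hk1, eventually_gt_atTop 0, eventually_ge_atTop k] with n hkn hn hnk
    have hb := bad_bound k r n (n ^ d) hkr hn hkn
    have htot : Nat.card (Fin (n ^ d) → {B : Finset (Fin n) // B.card = k}) =
        (n.choose k) ^ (n ^ d) := by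
      rw [Nat.card_eq_fintype_card, Fintype.card_fun, Fintype.card_finset_len, Fintype.card_fin,
        Fintype.card_fin]
    have hpos : (0 : ℝ) < (n.choose k : ℝ) ^ (n ^ d) := by
      have : 0 < n.choose k := Nat.choose_pos hnk
      positivity
    have hsplit := Nat.card_congr (Equiv.sumCompl
      (fun A : Fin (n ^ d) → {B : Finset (Fin n) // B.card = k} =>
          ∀ I : Finset (Fin (n ^ d)), I.Nonempty →
            (I.card : ℝ) ≤ (n : ℝ) ^ ((3 : ℝ) / 4) →
            I.card < 2 * (I.filter (fun i =>
              k - r ≤ ((A i).1 \ (I.erase i).biUnion (fun j => (A j).1)).card)).card))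
    rw [Nat.card_sum, htot] at hsplit
    have hsplit' := congrArg (Nat.cast : ℕ → ℝ) hsplit
    rw [Nat.cast_add, Nat.cast_pow] at hsplit'
    rw [htot, Nat.cast_pow (n.choose k) (n ^ d), le_div_iff₀ hpos, sub_mul, one_mul]
    linarith
  · refine Eventually.of_forall fun n => ?_
    refine div_le_one_of_le₀ ?_ (Nat.cast_nonneg _)
    exact_mod_cast Nat.card_le_card_of_injective _ Subtype.val_injective
end

section
/- Let K, n, M ≥ 1, let H : {±1}^K → {0,1}, and let b_{t,r} ∈ {±1} for t ∈ [M], r ∈ [K] be such that for all x ∈ {±1}^K, H(x) = 1 if and only if there exists t ∈ [M] with x_r = b_{t,r} for all r ∈ [K]. Let j_1, ..., j_K ∈ {±1} and let i_1, ..., i_K ∈ [n] be distinct, and consider the constraint C(x) = H(j_1 x_{i_1}, ..., j_K x_{i_K}) on {±1}^n. Index the coordinates of vectors in {±1}^{2Kn} by triples (l, b, i) ∈ [K] × {±1} × [n], and define Ψ(C) ∈ {±1}^{2Kn} by (Ψ(C))_{l,b,i} = −1 if (b,i) = (−j_l, i_l) and (Ψ(C))_{l,b,i} = 1 otherwise.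 For u ∈ {±1}^n, define φ_u : {±1}^{2Kn} → {0,1} by φ_u(z) = 1 if and only if there exists t ∈ [M] such that z_{(r, u_i·b_{t,r}, i)} = 1 for all r ∈ [K] and all i ∈ [n]. Then φ_u(Ψ(C)) = C(u) = H(j_1 u_{i_1}, ..., j_K u_{i_K}). -/
/-- Signs `±1` are formalized as `ℤˣ`.  Let `H : {±1}^K → {0,1}`
have the full DNF representation `H x = 1 ↔ ∃ t ∈ [M], ∀ r, x r = b t r`.  Let
`C(x) = H (j_1 x_{i_1}, …, j_K x_{i_K})` be an `H`-constraint on `{±1}^n` (with the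
`i_l` distinct), let `Ψ(C) ∈ {±1}^{2Kn}` (coordinates indexed by
`(l, s, i) ∈ [K] × {±1} × [n]`) be `-1` exactly at the coordinate `(l, -j_l, i_l)` of
each `l`, and for `u ∈ {±1}^n` let
`φ_u z = 1 ↔ ∃ t, ∀ r i, z (r, u_i · b_{t,r}, i) = 1`.  Then
`φ_u (Ψ C) = C(u) = H (j_1 u_{i_1}, …, j_K u_{i_K})`. -/
theorem stmt18 (K n M : ℕ) (hK : 1 ≤ K) (hn : 1 ≤ n) (hM : 1 ≤ M)
    (H : (Fin K → ℤˣ) → Bool) (b : Fin M → Fin K → ℤˣ)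
    (hH : ∀ x : Fin K → ℤˣ, H x = true ↔ ∃ t : Fin M, ∀ r : Fin K, x r = b t r)
    (j : Fin K → ℤˣ) (ii : Fin K → Fin n) (hii : Function.Injective ii)
    (u : Fin n → ℤˣ)
    (ΨC : Fin K × ℤˣ × Fin n → ℤˣ)
    (hΨ : ∀ (l : Fin K) (s : ℤˣ) (i : Fin n),
      ΨC (l, s, i) = if (s, i) = (-(j l), ii l) then -1 else 1)
    (φ : (Fin K × ℤˣ × Fin n → ℤˣ) → Bool)
    (hφ : ∀ z : Fin K × ℤˣ × Fin n → ℤˣ,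
      φ z = true ↔ ∃ t : Fin M, ∀ (r : Fin K) (i : Fin n), z (r, u i * b t r, i) = 1) :
    φ ΨC = H (fun l => j l * u (ii l)) := by
  have key : ∀ a c d : ℤˣ, (a * c = -d) ↔ ¬ (d * a = c) := by decide
  have hne : (-1 : ℤˣ) ≠ 1 := by decide
  rw [Bool.eq_iff_iff, hφ, hH]
  refine exists_congr fun t => forall_congr' fun r => ?_
  constructor
  · intro h
    have h1 := h (ii r)
    rw [hΨ] at h1
    by_contra hc
    rw [if_pos (by rw [(key _ _ _).2 hc])] at h1
    exact hne h1
  · intro h i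
    rw [hΨ, if_neg]
    intro he
    obtain ⟨h1, h2⟩ := Prod.mk.inj he
    subst h2
    exact (key _ _ _).1 h1 h
end
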